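/- arXiv:1012.4200 — 7 statements merged into one kernel-verified Lean document; each statement's English description precedes it below -/
import Mathlib

section
/- Let (V,‖·‖) be a finite-dimensional real normed vector space and let K ⊆ V be a nonempty convex cone with K ≠ V. Then for all v, w ∈ K, dist(v + w, ∂K) ≥ dist(v, ∂K) + dist(w, ∂K). -/
/-- The open ball around a point of `K` whose radius is the distance to the frontier lies in `K`. -/
theorem ball_infDist_frontier_subset {V : Type*} [NormedAddCommGroup V] [NormedSpace ℝ V]
    {K : Set V} {v : V} (hv : v ∈ K) : Metric.ball v (Metric.infDist v (frontier K)) ⊆ K := by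
  intro y hy
  by_contra hyK
  have hpos : 0 < Metric.infDist v (frontier K) := dist_nonneg.trans_lt hy
  have hcover : Metric.ball v (Metric.infDist v (frontier K)) ⊆ interior K ∪ (closure K)ᶜ := by
    intro z hz
    by_contra h
    rw [Set.mem_union, Set.mem_compl_iff, not_or, not_not] at h
    exact Set.disjoint_left.1 Metric.disjoint_ball_infDist hz ⟨h.2, h.1⟩
  have hvball := Metric.mem_ball_self (x := v) hpos
  have hvint : v ∈ interior K := (hcover hvball).resolve_right fun h => h (subset_closure hv)
  have hyext : y ∈ (closure K)ᶜ := (hcover hy).resolve_left fun h => hyK (interior_subset h)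
  obtain ⟨z, -, hzint, hzext⟩ := (convex_ball v _).isPreconnected _ _ isOpen_interior
    isClosed_closure.isOpen_compl hcover ⟨v, hvball, hvint⟩ ⟨y, hy, hyext⟩
  exact hzext (interior_subset_closure hzint)

/-- Translating a point of `K` by its distance to the frontier times a vector of norm less than one
stays in `K`. -/
theorem add_smul_infDist_frontier_mem {V : Type*} [NormedAddCommGroup V] [NormedSpace ℝ V]
    {K : Set V} {v u : V} (hv : v ∈ K) (hu : ‖u‖ < 1) :
    v + Metric.infDist v (frontier K) • u ∈ K := by
  rcases (Metric.infDist_nonneg (x := v) (s := frontier K)).eq_or_lt with h | h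
  · simpa [← h] using hv
  · apply ball_infDist_frontier_subset hv
    rw [mem_ball_iff_norm, add_sub_cancel_left, norm_smul, Real.norm_of_nonneg h.le]
    exact mul_lt_of_lt_one_right h hu

/-- For a nonempty convex cone `K ≠ V` in a finite-dimensional real normed vector space,
`dist(v + w, ∂K) ≥ dist(v, ∂K) + dist(w, ∂K)` for all `v, w ∈ K`. -/
theorem dist_frontier_superadditive_on_cone
    {V : Type*} [NormedAddCommGroup V] [NormedSpace ℝ V] [FiniteDimensional ℝ V]
    (K : Set V) (hconv : Convex ℝ K)
    (hcone : ∀ c : ℝ, 0 < c → ∀ v ∈ K, c • v ∈ K)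
    (hne : K.Nonempty) (hKuniv : K ≠ Set.univ) :
    ∀ v ∈ K, ∀ w ∈ K,
      Metric.infDist v (frontier K) + Metric.infDist w (frontier K) ≤
        Metric.infDist (v + w) (frontier K) := by
  intro v hv w hw
  have hadd : ∀ x ∈ K, ∀ y ∈ K, x + y ∈ K := fun x hx y hy => by
    have h := hcone 2 two_pos _
      (hconv hx hy (by norm_num : (0 : ℝ) ≤ 1 / 2) (by norm_num : (0 : ℝ) ≤ 1 / 2) (by norm_num))
    simpa [smul_smul] using h
  have hfr : (frontier K).Nonempty := nonempty_frontier_iff.2 ⟨hne, hKuniv⟩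
  set r := Metric.infDist v (frontier K) + Metric.infDist w (frontier K) with hr
  have hball : Metric.ball (v + w) r ⊆ K := by
    intro y hy
    have hpos : 0 < r := dist_nonneg.trans_lt hy
    have hu : ‖r⁻¹ • (y - (v + w))‖ < 1 := by
      rw [norm_smul, norm_inv, Real.norm_of_nonneg hpos.le, inv_mul_lt_one₀ hpos]
      exact mem_ball_iff_norm.1 hy
    have h := hadd _ (add_smul_infDist_frontier_mem hv hu) _ (add_smul_infDist_frontier_mem hw hu)
    rwa [add_add_add_comm, ← add_smul, ← hr, smul_inv_smul₀ hpos.ne', add_sub_cancel] at h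
  refine (Metric.le_infDist hfr).2 fun y hy => le_of_not_gt fun hlt => ?_
  exact hy.2 (interior_maximal hball Metric.isOpen_ball (Metric.mem_ball'.2 hlt))
end

section
/- Let (V,‖·‖) be a finite-dimensional real normed vector space, let K ⊆ V be a nonempty convex cone with K ≠ V, and let ε > 0. Then the set K_ε := {v ∈ K : dist(v, ∂K) ≥ ε‖v‖} is a convex cone. -/
open scoped Pointwise in
theorem frontier_smul_set₀ {V : Type*} [NormedAddCommGroup V] [NormedSpace ℝ V]
    {c : ℝ} (hc : c ≠ 0) (s : Set V) : frontier (c • s) = c • frontier s := by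
  simp only [frontier, Set.smul_set_sdiff₀ hc, interior_smul₀ hc, closure_smul₀' hc]

theorem ball_infDist_frontier_subset_interior {V : Type*} [NormedAddCommGroup V]
    [NormedSpace ℝ V] {s : Set V} {x : V} (hx : x ∈ s) :
    Metric.ball x (Metric.infDist x (frontier s)) ⊆ interior s := by
  rcases (Metric.infDist_nonneg (x := x) (s := frontier s)).eq_or_lt with h | h
  · simp [← h]
  have hcompl := Metric.ball_infDist_subset_compl (x := x) (s := frontier s)
  refine (convex_ball x _).isPreconnected.subset_left_of_subset_union isOpen_interior
    (isClosed_closure (s := s)).isOpen_compl ?_ ?_ ?_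
  · exact Set.disjoint_compl_right_iff_subset.2 interior_subset_closure
  · intro y hy
    by_cases hcl : y ∈ closure s
    · exact Or.inl (by_contra fun hi => hcompl hy ⟨hcl, hi⟩)
    · exact Or.inr hcl
  · refine ⟨x, Metric.mem_ball_self h, by_contra fun hi => ?_⟩
    exact hcompl (Metric.mem_ball_self h) ⟨subset_closure hx, hi⟩

theorem add_infDist_frontier_smul_mem {V : Type*} [NormedAddCommGroup V]
    [NormedSpace ℝ V] {s : Set V} {x t : V} (hx : x ∈ s) (ht : ‖t‖ < 1) :
    x + Metric.infDist x (frontier s) • t ∈ s := by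
  rcases (Metric.infDist_nonneg (x := x) (s := frontier s)).eq_or_lt with h | h
  · simpa [← h] using hx
  refine interior_subset (ball_infDist_frontier_subset_interior hx ?_)
  rw [mem_ball_iff_norm, add_sub_cancel_left, norm_smul, Real.norm_of_nonneg h.le]
  exact mul_lt_of_lt_one_right h ht

/-- The distance to the frontier of a convex set is concave on that set. -/
theorem Convex.concaveOn_infDist_frontier {V : Type*} [NormedAddCommGroup V]
    [NormedSpace ℝ V] {s : Set V} (hs : Convex ℝ s) :
    ConcaveOn ℝ s fun x => Metric.infDist x (frontier s) := by
  refine ⟨hs, fun x hx y hy a b ha hb hab => ?_⟩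
  rcases (frontier s).eq_empty_or_nonempty with he | hne
  · simp [he]
  simp only [smul_eq_mul]
  set r := a * Metric.infDist x (frontier s) + b * Metric.infDist y (frontier s) with hr
  rw [Metric.le_infDist hne]
  intro w hw
  by_contra! hlt
  have hr0 : 0 < r := dist_nonneg.trans_lt hlt
  refine hw.2 (interior_maximal (t := Metric.ball (a • x + b • y) r) (fun z hz => ?_)
    Metric.isOpen_ball (Metric.mem_ball'.2 hlt))
  have ht : ‖r⁻¹ • (z - (a • x + b • y))‖ < 1 := by
    rw [norm_smul, norm_inv, Real.norm_of_nonneg hr0.le, inv_mul_lt_one₀ hr0]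
    exact mem_ball_iff_norm.1 hz
  have hmem := hs (add_infDist_frontier_smul_mem hx ht) (add_infDist_frontier_smul_mem hy ht)
    ha hb hab
  have hz' : r • r⁻¹ • (z - (a • x + b • y)) = z - (a • x + b • y) :=
    smul_inv_smul₀ hr0.ne' _
  convert hmem using 1
  generalize r⁻¹ • (z - (a • x + b • y)) = t at hz'
  rw [eq_add_of_sub_eq hz'.symm, hr]
  module

/-- For a nonempty convex cone `K ≠ V` in a finite-dimensional real normed vector space
and `ε > 0`, the set `K_ε = {v ∈ K : dist(v, ∂K) ≥ ε‖v‖}` is a convex cone. -/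
theorem Keps_convex_cone
    {V : Type*} [NormedAddCommGroup V] [NormedSpace ℝ V] [FiniteDimensional ℝ V]
    (K : Set V) (hconv : Convex ℝ K)
    (hcone : ∀ c : ℝ, 0 < c → ∀ v ∈ K, c • v ∈ K)
    (hne : K.Nonempty) (hKuniv : K ≠ Set.univ)
    (ε : ℝ) (hε : 0 < ε) :
    Convex ℝ {v | v ∈ K ∧ ε * ‖v‖ ≤ Metric.infDist v (frontier K)} ∧
      ∀ c : ℝ, 0 < c →
        ∀ v ∈ {v | v ∈ K ∧ ε * ‖v‖ ≤ Metric.infDist v (frontier K)},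
          c • v ∈ {v | v ∈ K ∧ ε * ‖v‖ ≤ Metric.infDist v (frontier K)} := by
  refine ⟨fun x hx y hy a b ha hb hab => ⟨hconv hx.1 hy.1 ha hb hab, ?_⟩,
    fun c hc v hv => ⟨hcone c hc v hv.1, ?_⟩⟩
  · calc ε * ‖a • x + b • y‖ ≤ ε * (a * ‖x‖ + b * ‖y‖) := by
          gcongr
          refine (norm_add_le _ _).trans_eq ?_
          rw [norm_smul, norm_smul, Real.norm_of_nonneg ha, Real.norm_of_nonneg hb]
      _ = a * (ε * ‖x‖) + b * (ε * ‖y‖) := by ring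
      _ ≤ a * Metric.infDist x (frontier K) + b * Metric.infDist y (frontier K) := by
          gcongr
          exacts [hx.2, hy.2]
      _ ≤ Metric.infDist (a • x + b • y) (frontier K) :=
          hconv.concaveOn_infDist_frontier.2 hx.1 hy.1 ha hb hab
  · open scoped Pointwise in
    have hK : c • K = K := by
      refine Set.Subset.antisymm (Set.smul_set_subset_iff.2 fun v hv => hcone c hc v hv) ?_
      exact fun v hv => ⟨c⁻¹ • v, hcone _ (inv_pos.2 hc) v hv, smul_inv_smul₀ hc.ne' v⟩
    have hdist := infDist_smul₀ hc.ne' (frontier K) v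
    rw [← frontier_smul_set₀ hc.ne', hK, Real.norm_of_nonneg hc.le] at hdist
    rw [hdist, norm_smul, Real.norm_of_nonneg hc.le, mul_left_comm]
    exact mul_le_mul_of_nonneg_left hv.2 hc.le
end

section
/- Let (V,‖·‖) be a real normed vector space of finite dimension b ≥ 1 and let K ⊆ V be a closed convex cone with K ≠ V. Assume δ ∈ (0,1) is such that ‖g₁ + ⋯ + g_m‖ ≥ δ·(‖g₁‖ + ⋯ + ‖g_m‖) for every finite family g₁,…,g_m ∈ K. Let ε > 0, let N ≥ b, and let h₁,…,h_N ∈ K \ {0} satisfy ‖h_i‖ ≤ 2‖h_j‖ for all 1 ≤ i,j ≤ N as well as dist(h₁ + ⋯ + h_N, ∂K) ≥ ε‖h₁ + ⋯ + h_N‖. Then, setting η := δε/(8b), there exists a subset S ⊆ {1,…,N} with exactly b elements such that dist(Σ_{i∈S} h_i, ∂K) ≥ η·‖Σ_{i∈S} h_i‖. -/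
/-- A linear relation among more than `finrank` vectors, normalized to have a positive
coefficient. -/
theorem exists_relation_pos_of_finrank_lt_card {V ι : Type*} [AddCommGroup V] [Module ℝ V]
    [FiniteDimensional ℝ V] (v : ι → V) (T : Finset ι) (hT : Module.finrank ℝ V < T.card) :
    ∃ g : ι → ℝ, ∑ i ∈ T, g i • v i = 0 ∧ ∃ i ∈ T, 0 < g i := by
  have hdep : ¬ LinearIndepOn ℝ v (T : Set ι) := fun hli => by
    have := LinearIndependent.fintype_card_le_finrank (R := ℝ) hli
    simp at this
    omega
  rw [linearIndepOn_finset_iff] at hdep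
  push Not at hdep
  obtain ⟨g, hg, i, hi, hgi⟩ := hdep
  rcases hgi.lt_or_gt with hneg | hpos
  · exact ⟨-g, by simp [hg], i, hi, by simpa using hneg⟩
  · exact ⟨g, hg, i, hi, hpos⟩

/-- Carathéodory's theorem for conic combinations. -/
theorem exists_conic_combination_card_le_finrank {V ι : Type*} [AddCommGroup V] [Module ℝ V]
    [FiniteDimensional ℝ V] (v : ι → V) (T : Finset ι) (c : ι → ℝ) (hc : ∀ i ∈ T, 0 ≤ c i) :
    ∃ (S : Finset ι) (a : ι → ℝ), S.card ≤ Module.finrank ℝ V ∧ (∀ i ∈ S, 0 ≤ a i) ∧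
      ∑ i ∈ S, a i • v i = ∑ i ∈ T, c i • v i := by
  classical
  induction hn : T.card using Nat.strong_induction_on generalizing T c with
  | _ n ih =>
    by_cases hT : T.card ≤ Module.finrank ℝ V
    · exact ⟨T, c, hT, hc, rfl⟩
    obtain ⟨g, hg, j, hj, hgj⟩ := exists_relation_pos_of_finrank_lt_card v T (not_le.1 hT)
    obtain ⟨k, hk, hmin⟩ := (T.filter fun i => 0 < g i).exists_min_image (fun i => c i / g i)
      ⟨j, by simp [hj, hgj]⟩
    rw [Finset.mem_filter] at hk
    obtain ⟨hkT, hgk⟩ := hk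
    have hck : 0 ≤ c k / g k := div_nonneg (hc k hkT) hgk.le
    obtain ⟨S, a, hS, ha, hsum⟩ := ih (T.erase k).card
      (hn ▸ Finset.card_erase_lt_of_mem hkT) (T.erase k) (fun i => c i - c k / g k * g i)
      (fun i hi => by
        have hiT := Finset.mem_of_mem_erase hi
        rcases le_or_gt (g i) 0 with hle | hlt
        · nlinarith [hc i hiT]
        · have := hmin i (by simp [hiT, hlt])
          rw [le_div_iff₀ hlt] at this
          linarith) rfl
    refine ⟨S, a, hS, ha, hsum.trans ?_⟩
    rw [Finset.sum_erase _ (by simp [hgk.ne'])]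
    simp only [sub_smul, mul_smul, Finset.sum_sub_distrib, ← Finset.smul_sum, hg, smul_zero,
      sub_zero]

/-- A point of `K` is at distance at least `r` from `frontier K` iff the ball of radius `r`
around it is contained in `K`. -/
theorem le_infDist_frontier_iff_ball_subset {V : Type*} [NormedAddCommGroup V] [NormedSpace ℝ V]
    {K : Set V} (hK : K ≠ Set.univ) {x : V} (hx : x ∈ K) {r : ℝ} :
    r ≤ Metric.infDist x (frontier K) ↔ Metric.ball x r ⊆ K := by
  have hfr : (frontier K).Nonempty := nonempty_frontier_iff.2 ⟨⟨x, hx⟩, hK⟩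
  constructor
  · intro hr y hy
    have hdisj {z : V} (hz : z ∈ Metric.ball x r) : z ∉ frontier K := fun hzf => by
      have := Metric.infDist_le_dist_of_mem (x := x) hzf
      rw [Metric.mem_ball, dist_comm] at hz
      linarith
    have hxr : x ∈ Metric.ball x r := Metric.mem_ball_self (Metric.pos_of_mem_ball hy)
    refine interior_subset ((convex_ball x r).isPreconnected.subset_left_of_subset_union
      isOpen_interior isClosed_closure.isOpen_compl
      (disjoint_compl_right.mono_left (interior_subset.trans subset_closure))
      (fun z hz => ?_) ⟨x, hxr, ?_⟩ hy)
    · by_contra hcon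
      rw [Set.mem_union, not_or, Set.notMem_compl_iff] at hcon
      exact hdisj hz ⟨hcon.2, hcon.1⟩
    · by_contra hcon
      exact hdisj hxr ⟨subset_closure hx, hcon⟩
  · intro hsub
    refine (Metric.le_infDist hfr).2 fun y hy => ?_
    by_contra hlt
    refine hy.2 (interior_maximal hsub Metric.isOpen_ball ?_)
    rw [Metric.mem_ball, dist_comm]
    exact not_le.1 hlt

theorem zero_mem_of_isClosed_cone {V : Type*} [NormedAddCommGroup V] [NormedSpace ℝ V]
    {K : Set V} (hclosed : IsClosed K) (hcone : ∀ c : ℝ, 0 < c → ∀ v ∈ K, c • v ∈ K)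
    {x : V} (hx : x ∈ K) : (0 : V) ∈ K := by
  have hlim : Filter.Tendsto (fun c : ℝ => c • x) (nhdsWithin 0 (Set.Ioi 0)) (nhds 0) := by
    have : Continuous fun c : ℝ => c • x := by fun_prop
    simpa using (this.tendsto 0).mono_left nhdsWithin_le_nhds
  exact hclosed.mem_of_tendsto hlim
    (Filter.eventually_of_mem self_mem_nhdsWithin fun c hc => hcone c hc x hx)

theorem sum_smul_mem_of_cone {V ι : Type*} [AddCommGroup V] [Module ℝ V]
    {K : Set V} (hconv : Convex ℝ K) (hcone : ∀ c : ℝ, 0 < c → ∀ v ∈ K, c • v ∈ K)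
    (h0 : (0 : V) ∈ K) (S : Finset ι) (v : ι → V) (hv : ∀ i ∈ S, v i ∈ K)
    (c : ι → ℝ) (hc : ∀ i ∈ S, 0 ≤ c i) : ∑ i ∈ S, c i • v i ∈ K := by
  let C : ConvexCone ℝ V :=
    { carrier := K
      smul_mem' := fun c hc v hv => hcone c hc v hv
      add_mem' := fun x hx y hy => by
        have := hcone 2 two_pos _ (hconv hx hy (by norm_num : (0 : ℝ) ≤ 1 / 2)
          (by norm_num : (0 : ℝ) ≤ 1 / 2) (by norm_num))
        simpa [smul_add, smul_smul] using this }
  refine Finset.sum_induction _ (· ∈ C) (fun _ _ hx hy => C.add_mem hx hy) h0 fun i hi => ?_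
  rcases (hc i hi).eq_or_lt with h | h
  · rw [← h, zero_smul]
    exact h0
  · exact hcone _ h _ (hv i hi)


/-- From a family of comparable vectors of `K` whose sum lies in `K_ε`, one can select
`b = dim V` of them whose sum lies in `K_η`, with `η = δε/(8b)`. -/
theorem exists_subfamily_in_K_eta
    {V : Type*} [NormedAddCommGroup V] [NormedSpace ℝ V] [FiniteDimensional ℝ V]
    (hb : 1 ≤ Module.finrank ℝ V)
    (K : Set V) (hclosed : IsClosed K) (hconv : Convex ℝ K)
    (hcone : ∀ c : ℝ, 0 < c → ∀ v ∈ K, c • v ∈ K) (hKuniv : K ≠ Set.univ)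
    (δ : ℝ) (hδ : δ ∈ Set.Ioo (0 : ℝ) 1)
    (hδsum : ∀ (m : ℕ) (g : Fin m → V), (∀ i, g i ∈ K) →
      δ * ∑ i, ‖g i‖ ≤ ‖∑ i, g i‖)
    (ε : ℝ) (hε : 0 < ε) (N : ℕ) (hN : Module.finrank ℝ V ≤ N)
    (h : Fin N → V) (hmem : ∀ i, h i ∈ K) (hne : ∀ i, h i ≠ 0)
    (hcomp : ∀ i j, ‖h i‖ ≤ 2 * ‖h j‖)
    (hsum : ε * ‖∑ i, h i‖ ≤ Metric.infDist (∑ i, h i) (frontier K)) :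
    ∃ S : Finset (Fin N), S.card = Module.finrank ℝ V ∧
      (δ * ε / (8 * (Module.finrank ℝ V : ℝ))) * ‖∑ i ∈ S, h i‖ ≤
        Metric.infDist (∑ i ∈ S, h i) (frontier K) := by
  classical
  obtain ⟨hδ0, -⟩ := hδ
  let i₀ : Fin N := ⟨0, by omega⟩
  have h0 : (0 : V) ∈ K := zero_mem_of_isClosed_cone hclosed hcone (hmem i₀)
  have hcomb {ι : Type} (S : Finset ι) (v : ι → V) (hv : ∀ i ∈ S, v i ∈ K) (c : ι → ℝ)
      (hc : ∀ i ∈ S, 0 ≤ c i) : ∑ i ∈ S, c i • v i ∈ K :=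
    sum_smul_mem_of_cone hconv hcone h0 S v hv c hc
  have hsumK (S : Finset (Fin N)) : ∑ i ∈ S, h i ∈ K := by
    simpa using hcomb S h (fun i _ => hmem i) 1 (by simp)
  obtain ⟨T, c, hTcard, hc, hTsum⟩ :=
    exists_conic_combination_card_le_finrank h Finset.univ 1 (by simp)
  simp only [Pi.one_apply, one_smul] at hTsum
  obtain ⟨S, hTS, hScard⟩ := Finset.exists_superset_card_eq hTcard (by simpa using hN)
  refine ⟨S, hScard, ?_⟩
  set w := ∑ i, h i
  set u := ∑ i ∈ S, h i with hu
  set a := ‖h i₀‖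
  have ha0 : 0 < a := norm_pos_iff.2 (hne i₀)
  have hw0 : 0 < ‖w‖ := by
    refine lt_of_lt_of_le (mul_pos hδ0 ?_) (hδsum N h hmem)
    exact ha0.trans_le (Finset.single_le_sum (f := fun i => ‖h i‖) (by simp) (Finset.mem_univ i₀))
  -- The coefficients of the conic combination, extended by zero, are uniformly bounded.
  let d : Fin N → ℝ := fun i => if i ∈ T then c i else 0
  have hd0 (i : Fin N) : 0 ≤ d i := by
    by_cases hi : i ∈ T <;> simp [d, hi, hc]
  have hdsum (R : Finset (Fin N)) (hR : T ⊆ R) : ∑ i ∈ R, d i • h i = w := by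
    rw [← hTsum, ← Finset.sum_subset hR (fun i _ hi => by simp [d, hi])]
    exact Finset.sum_congr rfl fun i hi => by simp [d, hi]
  set M := 2 * ‖w‖ / (δ * a) with hM
  have hM0 : 0 < M := by positivity
  have hdM (i : Fin N) : d i ≤ M := by
    have hbound := hδsum N (fun i => d i • h i) fun i => by
      simpa using hcomb {i} h (fun i _ => hmem i) d fun i _ => hd0 i
    rw [hdsum _ (Finset.subset_univ _)] at hbound
    have hsingle := Finset.single_le_sum (f := fun i => ‖d i • h i‖) (by simp) (Finset.mem_univ i)
    simp only [norm_smul, Real.norm_of_nonneg (hd0 _)] at hsingle hbound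
    have h1 : d i * a ≤ d i * (2 * ‖h i‖) := mul_le_mul_of_nonneg_left (hcomp i₀ i) (hd0 i)
    have h2 := mul_le_mul_of_nonneg_left hsingle hδ0.le
    rw [hM, le_div_iff₀ (by positivity)]
    nlinarith [mul_le_mul_of_nonneg_left h1 hδ0.le]
  have hrest : M • u - w ∈ K := by
    have : M • u - w = ∑ i ∈ S, (M - d i) • h i := by
      simp only [sub_smul, Finset.sum_sub_distrib, hdsum S hTS, hu, Finset.smul_sum]
    rw [this]
    exact hcomb S h (fun i _ => hmem i) _ fun i _ => sub_nonneg.2 (hdM i)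
  have hball := (le_infDist_frontier_iff_ball_subset hKuniv (hsumK Finset.univ)).1 hsum
  have hdist : ε * ‖w‖ / M ≤ Metric.infDist u (frontier K) := by
    refine (le_infDist_frontier_iff_ball_subset hKuniv (hsumK S)).2 fun y hy => ?_
    have hshift : w + M • (y - u) ∈ K := hball <| by
      rw [mem_ball_iff_norm, lt_div_iff₀ hM0] at hy
      rw [mem_ball_iff_norm, add_sub_cancel_left, norm_smul, Real.norm_of_nonneg hM0.le]
      linarith
    have hadd := hcomb Finset.univ ![w + M • (y - u), M • u - w]
      (by simp [Fin.forall_fin_two, hshift, hrest]) (fun _ => M⁻¹) (by simp [hM0.le])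
    convert hadd using 1
    rw [← Finset.smul_sum, eq_inv_smul_iff₀ hM0.ne']
    simp only [smul_sub, Fin.sum_univ_two, Matrix.cons_val_zero, Matrix.cons_val_one]
    abel
  have hunorm : ‖u‖ ≤ Module.finrank ℝ V * (2 * a) := by
    rw [← hScard, ← nsmul_eq_mul]
    exact (norm_sum_le _ _).trans (Finset.sum_le_card_nsmul _ _ _ fun i _ => hcomp i i₀)
  have hb0 : (0 : ℝ) < Module.finrank ℝ V := by exact_mod_cast hb
  calc δ * ε / (8 * Module.finrank ℝ V) * ‖u‖
      ≤ δ * ε / (8 * Module.finrank ℝ V) * (Module.finrank ℝ V * (2 * a)) := by gcongr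
    _ = δ * ε * a / 4 := by field_simp; norm_num
    _ ≤ δ * ε * a / 2 := by gcongr; norm_num
    _ = ε * ‖w‖ / M := by rw [hM]; field_simp
    _ ≤ Metric.infDist u (frontier K) := hdist
end

section
/- Let C ≥ 0 and let F : ℕ → ℝ be a nonnegative function that is coarse-Lipschitz with defect C, i.e. there exists L ≥ 0 such that |F(s) − F(t)| ≤ L·|s−t| + C for all s, t ∈ ℕ. Assume moreover that for all s ∈ ℕ one has 2F(s) − F(2s) ≤ C, F(2s) − 2F(s) ≤ C, and F(3s) − 3F(s) ≤ C. Then there exists a real number 𝔞 such that |F(s) − 𝔞·s| ≤ 2C for all s ∈ ℕ. -/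
open Filter Topology

theorem irrational_log_three_div_log_two : Irrational (Real.log 3 / Real.log 2) := by
  have hl2 : 0 < Real.log 2 := Real.log_pos (by norm_num)
  have hl3 : 0 < Real.log 3 := Real.log_pos (by norm_num)
  rintro ⟨q, hq⟩
  have hqpos : 0 < q := by
    have : (0 : ℝ) < q := hq ▸ div_pos hl3 hl2
    exact_mod_cast this
  obtain ⟨m, hm⟩ := Int.eq_ofNat_of_zero_le (Rat.num_pos.2 hqpos).le
  have hden : (q.den : ℝ) ≠ 0 := by exact_mod_cast q.den_nz
  have hlog : (q.den : ℝ) * Real.log 3 = m * Real.log 2 := by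
    rw [Rat.cast_def, hm, div_eq_div_iff hden hl2.ne'] at hq
    push_cast at hq
    linarith
  have hpow : (3 : ℝ) ^ q.den = 2 ^ m := by
    rw [← Real.log_pow, ← Real.log_pow] at hlog
    exact Real.log_injOn_pos (by simp) (by simp) hlog
  have hpow' : 3 ^ q.den = 2 ^ m := by exact_mod_cast hpow
  have hodd : Odd (2 ^ m) := hpow' ▸ (Odd.pow (by decide) : Odd (3 ^ q.den))
  have hm0 : m = 0 := by
    by_contra h
    exact (Nat.not_odd_iff_even.2 ((even_two).pow_of_ne_zero h)) hodd
  have : 0 < q.num := Rat.num_pos.2 hqpos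
  omega

/-- Nonnegative multiples of `a` are dense modulo `p` when `a / p` is irrational. -/
theorem exists_nat_mul_add_int_mul_near {a p : ℝ} (hp : 0 < p) (h : Irrational (a / p))
    (x : ℝ) {δ : ℝ} (hδ : 0 < δ) : ∃ (n : ℕ) (k : ℤ), |n * a + k * p - x| < δ := by
  have : Fact (0 < p) := ⟨hp⟩
  have hd : DenseRange (fun n : ℕ => n • (a : AddCircle p)) :=
    denseRange_zsmul_iff_nsmul.1 (AddCircle.denseRange_zsmul_coe_iff.2 h)
  have hd' := QuotientAddGroup.dense_preimage_mk.2 hd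
  obtain ⟨y, ⟨n, hn⟩, hy⟩ := Metric.dense_iff.1 hd' x δ hδ |>.imp fun _ h => h.symm
  have hz : ((y - n * a : ℝ) : AddCircle p) = 0 := by
    rw [AddCircle.coe_sub, sub_eq_zero, ← nsmul_eq_mul, AddCircle.coe_nsmul]
    exact hn.symm
  obtain ⟨k, hk⟩ := AddCircle.coe_eq_zero_iff p |>.1 hz
  refine ⟨n, k, ?_⟩
  rw [Metric.mem_ball, Real.dist_eq] at hy
  rw [zsmul_eq_mul] at hk
  rwa [hk, add_sub_cancel]

/-- Up to a factor `1 + ε`, every ratio of positive reals has the form `3 ^ n * 2 ^ i`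
with `n : ℕ` and `i : ℤ`. -/
theorem exists_three_pow_mul_two_pow_near {s t : ℝ} (hs : 0 < s) (ht : 0 < t) {ε : ℝ}
    (hε : 0 < ε) : ∃ n k j : ℕ, 3 ^ n * 2 ^ k * t ≤ (1 + ε) * (2 ^ j * s) ∧
      2 ^ j * s ≤ (1 + ε) * (3 ^ n * 2 ^ k * t) := by
  obtain ⟨n, k, hnk⟩ := exists_nat_mul_add_int_mul_near (Real.log_pos (by norm_num))
    irrational_log_three_div_log_two (Real.log s - Real.log t)
    (Real.log_pos (by linarith : 1 < 1 + ε))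
  obtain ⟨c, d, hcd⟩ : ∃ c d : ℕ, k = c - d := ⟨k.toNat, (-k).toNat, by omega⟩
  have hA : Real.log (3 ^ n * 2 ^ c * t) = n * Real.log 3 + c * Real.log 2 + Real.log t := by
    rw [Real.log_mul (by positivity) ht.ne', Real.log_mul (by positivity) (by positivity),
      Real.log_pow, Real.log_pow]
  have hB : Real.log (2 ^ d * s) = d * Real.log 2 + Real.log s := by
    rw [Real.log_mul (by positivity) hs.ne', Real.log_pow]
  rw [hcd, abs_lt] at hnk
  push_cast at hnk
  refine ⟨n, c, d, ?_, ?_⟩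
  all_goals
    rw [← Real.log_le_log_iff (by positivity) (by positivity),
      Real.log_mul (by positivity : 1 + ε ≠ 0) (by positivity), hA, hB]
    linarith

/-- A nonnegative Lipschitz function that is homogeneous under doubling and subhomogeneous under
tripling has constant ratio `G s / s`. -/
theorem mul_le_mul_of_lipschitz_of_two_mul_of_three_mul {G : ℕ → ℝ} {L : ℝ} (hL : 0 ≤ L)
    (hpos : ∀ s, 0 ≤ G s) (hlip : ∀ s t : ℕ, |G s - G t| ≤ L * |(s : ℝ) - t|)
    (h2 : ∀ s, G (2 * s) = 2 * G s) (h3 : ∀ s, G (3 * s) ≤ 3 * G s)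
    {s t : ℕ} (hs : 0 < s) (ht : 0 < t) : G s * t ≤ G t * s := by
  have h2pow (j s : ℕ) : G (2 ^ j * s) = 2 ^ j * G s := by
    induction j with
    | zero => simp
    | succ j ih => rw [pow_succ', mul_assoc, h2, ih]; ring
  have h3pow (n s : ℕ) : G (3 ^ n * s) ≤ 3 ^ n * G s := by
    induction n with
    | zero => simp
    | succ n ih =>
      rw [pow_succ', mul_assoc]
      calc G (3 * (3 ^ n * s)) ≤ 3 * G (3 ^ n * s) := h3 _
        _ ≤ 3 * (3 ^ n * G s) := by gcongr
        _ = 3 ^ (n + 1) * G s := by ring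
  have hs' : (0 : ℝ) < s := by exact_mod_cast hs
  have ht' : (0 : ℝ) < t := by exact_mod_cast ht
  have key (ε : ℝ) (hε : 0 < ε) : G s * t ≤ (1 + ε) * s * (G t + L * ε * t) := by
    obtain ⟨n, k, j, hA, hB⟩ := exists_three_pow_mul_two_pow_near hs' ht' hε
    set N : ℝ := 3 ^ n * 2 ^ k with hN
    have hNpos : 0 < N := by positivity
    have hdist : |2 ^ j * (s : ℝ) - N * t| ≤ ε * (N * t) := by
      rw [abs_le]
      constructor <;> nlinarith [mul_pos hNpos ht']
    have hGA : G (3 ^ n * (2 ^ k * t)) ≤ N * G t := by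
      calc _ ≤ 3 ^ n * G (2 ^ k * t) := h3pow _ _
        _ = N * G t := by rw [h2pow, hN]; ring
    have hGB : 2 ^ j * G s ≤ N * (G t + L * ε * t) := by
      have h := (le_abs_self _).trans (hlip (2 ^ j * s) (3 ^ n * (2 ^ k * t)))
      push_cast at h
      rw [h2pow, ← mul_assoc (3 ^ n : ℝ), ← hN] at h
      have := mul_le_mul_of_nonneg_left hdist hL
      linarith
    refine le_of_mul_le_mul_left ?_ hNpos
    calc N * (G s * t) = G s * (N * t) := by ring
      _ ≤ G s * ((1 + ε) * (2 ^ j * s)) := mul_le_mul_of_nonneg_left hA (hpos s)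
      _ = (1 + ε) * s * (2 ^ j * G s) := by ring
      _ ≤ (1 + ε) * s * (N * (G t + L * ε * t)) := by gcongr
      _ = N * ((1 + ε) * s * (G t + L * ε * t)) := by ring
  have hlim : Tendsto (fun ε : ℝ => (1 + ε) * s * (G t + L * ε * t)) (𝓝[>] 0)
      (𝓝 ((1 + 0) * s * (G t + L * 0 * t))) :=
    (Continuous.tendsto (by fun_prop) 0).mono_left nhdsWithin_le_nhds
  have := ge_of_tendsto hlim (eventually_mem_nhdsWithin.mono fun ε hε => key ε hε)
  linarith

/-- Burago-type lemma: a nonnegative coarse-Lipschitz function on `ℕ` that is almost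
homogeneous under doubling and tripling is within `2C` of a linear function. -/
theorem coarse_lipschitz_almost_linear
    (C : ℝ) (hC : 0 ≤ C) (F : ℕ → ℝ) (hFpos : ∀ s, 0 ≤ F s)
    (hlip : ∃ L : ℝ, 0 ≤ L ∧ ∀ s t : ℕ, |F s - F t| ≤ L * |(s : ℝ) - (t : ℝ)| + C)
    (h1 : ∀ s : ℕ, 2 * F s - F (2 * s) ≤ C)
    (h2 : ∀ s : ℕ, F (2 * s) - 2 * F s ≤ C)
    (h3 : ∀ s : ℕ, F (3 * s) - 3 * F s ≤ C) :
    ∃ a : ℝ, ∀ s : ℕ, |F s - a * (s : ℝ)| ≤ 2 * C := by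
  obtain ⟨L, hL, hlip⟩ := hlip
  have hstep (s n : ℕ) : dist (F (2 ^ n * s) / 2 ^ n) (F (2 ^ (n + 1) * s) / 2 ^ (n + 1))
      ≤ C / 2 / 2 ^ n := by
    have e : F (2 ^ n * s) / 2 ^ n - F (2 ^ (n + 1) * s) / 2 ^ (n + 1)
        = (2 * F (2 ^ n * s) - F (2 * (2 ^ n * s))) / 2 / 2 ^ n := by
      rw [pow_succ' 2 n, mul_assoc 2 (2 ^ n) s, pow_succ (2 : ℝ) n]
      field_simp
    rw [Real.dist_eq, e, abs_div, abs_div, abs_two, abs_of_pos (by positivity : (0 : ℝ) < 2 ^ n)]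
    gcongr
    exact abs_le.2 ⟨by linarith [h2 (2 ^ n * s)], h1 _⟩
  choose G hG using fun s => cauchySeq_tendsto_of_complete (cauchySeq_of_le_geometric_two (hstep s))
  have hFG (s : ℕ) : |F s - G s| ≤ C := by
    simpa [Real.dist_eq] using dist_le_of_le_geometric_two_of_tendsto₀ (hstep s) (hG s)
  have hzero (c : ℝ) : Tendsto (fun n : ℕ => c / (2 : ℝ) ^ n) atTop (𝓝 0) :=
    tendsto_const_nhds.div_atTop (tendsto_pow_atTop_atTop_of_one_lt one_lt_two)
  have hGpos (s : ℕ) : 0 ≤ G s :=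
    ge_of_tendsto' (hG s) fun n => div_nonneg (hFpos _) (by positivity)
  have hG2 (s : ℕ) : G (2 * s) = 2 * G s := by
    refine tendsto_nhds_unique (hG (2 * s))
      ((((tendsto_add_atTop_iff_nat 1).2 (hG s)).const_mul 2).congr fun n => ?_)
    rw [pow_succ 2 n, mul_assoc (2 ^ n) 2 s, pow_succ (2 : ℝ) n]
    field_simp
  have hG3 (s : ℕ) : G (3 * s) ≤ 3 * G s := by
    refine le_of_tendsto_of_tendsto' (hG (3 * s))
      (by simpa using ((hG s).const_mul 3).add (hzero C)) fun n => ?_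
    rw [← mul_div_assoc, ← add_div, mul_left_comm]
    gcongr
    linarith [h3 (2 ^ n * s)]
  have hGlip (s t : ℕ) : |G s - G t| ≤ L * |(s : ℝ) - t| := by
    refine le_of_tendsto_of_tendsto' ((hG s).sub (hG t)).abs
      (by simpa using (hzero C).const_add (L * |(s : ℝ) - t|)) fun n => ?_
    have hn : (0 : ℝ) < 2 ^ n := by positivity
    have h := hlip (2 ^ n * s) (2 ^ n * t)
    push_cast at h
    rw [← mul_sub, abs_mul, abs_of_pos hn] at h
    rw [← sub_div, abs_div, abs_of_pos hn, div_le_iff₀ hn, add_mul, div_mul_cancel₀ _ hn.ne']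
    linarith
  refine ⟨G 1, fun s => ?_⟩
  have hlin : G s = G 1 * s := by
    rcases Nat.eq_zero_or_pos s with rfl | hs
    · have := hG2 0
      simp only [mul_zero] at this
      simp only [Nat.cast_zero, mul_zero]
      linarith
    · have hle := mul_le_mul_of_lipschitz_of_two_mul_of_three_mul hL hGpos hGlip hG2 hG3 hs one_pos
      have hge := mul_le_mul_of_lipschitz_of_two_mul_of_three_mul hL hGpos hGlip hG2 hG3 one_pos hs
      rw [Nat.cast_one, mul_one] at hle hge
      exact le_antisymm hle hge
  rw [← hlin]
  linarith [hFG s]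
end

section
/- Let V be a real normed vector space of finite dimension n ≥ 1, let s < t be real numbers, and let γ : [s,t] → V be a continuous curve. Then there exist an integer k with 1 ≤ k ≤ ⌈n/2⌉ and real numbers s ≤ a₁ ≤ b₁ ≤ a₂ ≤ b₂ ≤ … ≤ a_k ≤ b_k ≤ t such that Σ_{i=1}^{k} (γ(b_i) − γ(a_i)) = (1/2)·(γ(t) − γ(s)). -/
/-! ### Mod 2 cochains on lists of vertices -/

/-- The mod 2 simplicial coboundary: the value of `coboundary φ` on a list is the sum of the values
of `φ` on the lists obtained by deleting one entry. -/
def coboundary {α : Type*} : (List α → ZMod 2) → List α → ZMod 2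
  | _, [] => 0
  | φ, v :: l => φ l + coboundary (fun τ => φ (v :: τ)) l

section Coboundary

variable {α β : Type*}

theorem coboundary_add (φ ψ : List α → ZMod 2) (l : List α) :
    coboundary (fun τ => φ τ + ψ τ) l = coboundary φ l + coboundary ψ l := by
  induction l generalizing φ ψ with
  | nil => simp [coboundary]
  | cons v l ih => simp only [coboundary, ih]; ring

theorem coboundary_const_mul (c : ZMod 2) (φ : List α → ZMod 2) (l : List α) :
    coboundary (fun τ => c * φ τ) l = c * coboundary φ l := by
  induction l generalizing φ with
  | nil => simp [coboundary]
  | cons v l ih => simp only [coboundary, ih]; ring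

theorem coboundary_coboundary (φ : List α → ZMod 2) (l : List α) :
    coboundary (coboundary φ) l = 0 := by
  induction l generalizing φ with
  | nil => simp [coboundary]
  | cons v l ih =>
    simp only [coboundary, coboundary_add]
    rw [ih, add_zero, CharTwo.add_self_eq_zero]

theorem coboundary_map (g : α → β) (φ : List β → ZMod 2) (l : List α) :
    coboundary φ (l.map g) = coboundary (fun τ => φ (τ.map g)) l := by
  induction l generalizing φ with
  | nil => simp [coboundary]
  | cons v l ih => simp [coboundary, ih]

theorem coboundary_congr {φ ψ : List α → ZMod 2} {l : List α}
    (h : ∀ τ, τ.Sublist l → τ.length + 1 = l.length → φ τ = ψ τ) :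
    coboundary φ l = coboundary ψ l := by
  induction l generalizing φ ψ with
  | nil => simp [coboundary]
  | cons v l ih =>
    simp only [coboundary]
    rw [h l (List.sublist_cons_self v l) (by simp)]
    congr 1
    exact ih fun τ hτ hl => h _ (hτ.cons_cons v) (by simpa using hl)

theorem coboundary_zero (l : List α) : coboundary (fun _ => 0) l = 0 := by
  simpa using coboundary_const_mul 0 (fun _ => 0) l

/-! ### Barycentric subdivision -/

/-- Auxiliary recursion for `subdivision`, on the number of vertices. -/
def subdivisionAux (b : List α → α) : ℕ → (List α → ZMod 2) → List α → ZMod 2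
  | 0, φ, σ => φ σ
  | k + 1, φ, σ => coboundary (subdivisionAux b k fun τ => φ (b σ :: τ)) σ

/-- The value of a cochain on the barycentric subdivision of a simplex, where `b σ` is used as the
barycenter of `σ`. -/
def subdivision (b : List α → α) (φ : List α → ZMod 2) (σ : List α) : ZMod 2 :=
  subdivisionAux b σ.length φ σ

theorem subdivisionAux_add (b : List α → α) (k : ℕ) (φ ψ : List α → ZMod 2) (σ : List α) :
    subdivisionAux b k (fun τ => φ τ + ψ τ) σ =
      subdivisionAux b k φ σ + subdivisionAux b k ψ σ := by
  induction k generalizing φ ψ σ with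
  | zero => rfl
  | succ k ih =>
    simp only [subdivisionAux]
    rw [← coboundary_add]
    congr 1
    funext τ
    exact ih _ _ τ

theorem subdivision_add (b : List α → α) (φ ψ : List α → ZMod 2) :
    subdivision b (φ + ψ) = subdivision b φ + subdivision b ψ :=
  funext fun σ => subdivisionAux_add b σ.length φ ψ σ

theorem subdivisionAux_coboundary (b : List α → α) (k : ℕ) (φ : List α → ZMod 2) (σ : List α)
    (hσ : σ.length = k + 1) :
    subdivisionAux b (k + 1) (coboundary φ) σ = coboundary (subdivisionAux b k φ) σ := by
  induction k generalizing φ σ with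
  | zero =>
    obtain ⟨v, rfl⟩ := List.length_eq_one_iff.1 hσ
    simp [subdivisionAux, coboundary]
  | succ k ih =>
    rw [subdivisionAux]
    have h : (subdivisionAux b (k + 1) fun τ => coboundary φ (b σ :: τ)) = fun τ =>
        subdivisionAux b (k + 1) φ τ +
          subdivisionAux b (k + 1) (coboundary fun ρ => φ (b σ :: ρ)) τ :=
      funext fun τ => subdivisionAux_add b (k + 1) _ _ τ
    rw [h, coboundary_add]
    rw [coboundary_congr (φ := subdivisionAux b (k + 1) (coboundary fun ρ => φ (b σ :: ρ)))
      fun τ _ hl => ih _ τ (by omega)]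
    have h0 := coboundary_coboundary (subdivisionAux b k fun ρ => φ (b σ :: ρ)) σ
    exact (congrArg _ h0).trans (add_zero _)

theorem subdivision_coboundary (b : List α → α) (φ : List α → ZMod 2) :
    subdivision b (coboundary φ) = coboundary (subdivision b φ) := by
  funext σ
  cases hσ : σ.length with
  | zero =>
    rw [List.length_eq_zero_iff.1 hσ]
    simp [subdivision, subdivisionAux, coboundary]
  | succ k =>
    rw [subdivision, hσ, subdivisionAux_coboundary b k φ σ hσ]
    refine coboundary_congr fun τ _ hl => ?_
    rw [subdivision, show τ.length = k by omega]

theorem subdivisionAux_map {b : List α → α} {g : α → α} (hb : ∀ σ, b (σ.map g) = g (b σ))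
    (k : ℕ) (φ : List α → ZMod 2) (σ : List α) :
    subdivisionAux b k φ (σ.map g) = subdivisionAux b k (fun τ => φ (τ.map g)) σ := by
  induction k generalizing φ σ with
  | zero => rfl
  | succ k ih =>
    simp only [subdivisionAux, coboundary_map, hb, List.map_cons]
    congr 1
    funext τ
    exact ih _ τ

theorem subdivision_map {b : List α → α} {g : α → α} (hb : ∀ σ, b (σ.map g) = g (b σ))
    (φ : List α → ZMod 2) :
    subdivision b (fun τ => φ (τ.map g)) = fun σ => subdivision b φ (σ.map g) := by
  funext σ
  simp [subdivision, subdivisionAux_map hb]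

theorem iterate_subdivision_add (b : List α → α) (m : ℕ) (φ ψ : List α → ZMod 2) :
    (subdivision b)^[m] (φ + ψ) = (subdivision b)^[m] φ + (subdivision b)^[m] ψ := by
  induction m with
  | zero => rfl
  | succ m ih => simp only [Function.iterate_succ_apply', ih, subdivision_add]

theorem iterate_subdivision_coboundary (b : List α → α) (m : ℕ) (φ : List α → ZMod 2) :
    (subdivision b)^[m] (coboundary φ) = coboundary ((subdivision b)^[m] φ) := by
  induction m with
  | zero => rfl
  | succ m ih => simp only [Function.iterate_succ_apply', ih, subdivision_coboundary]

theorem iterate_subdivision_map {b : List α → α} {g : α → α} (hb : ∀ σ, b (σ.map g) = g (b σ))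
    (m : ℕ) (φ : List α → ZMod 2) :
    (subdivision b)^[m] (fun τ => φ (τ.map g)) = fun σ => (subdivision b)^[m] φ (σ.map g) := by
  induction m with
  | zero => rfl
  | succ m ih => simp only [Function.iterate_succ_apply', ih, subdivision_map hb]

theorem iterate_subdivision_singleton {b : List α → α} {v : α} (hb : b [v] = v) (m : ℕ)
    (φ : List α → ZMod 2) : (subdivision b)^[m] φ [v] = φ [v] := by
  induction m with
  | zero => rfl
  | succ m ih =>
    rw [Function.iterate_succ_apply', ← ih]
    simp [subdivision, subdivisionAux, coboundary, hb]

/-! ### The cocycles detecting sign changes -/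

/-- The cup product of the coboundaries of the vertex labelings in the list. -/
def signChange : List (α → ZMod 2) → List α → ZMod 2
  | [] => coboundary fun σ => if σ.length = 0 then 1 else 0
  | w :: ws => coboundary fun σ => σ.head?.elim 0 w * signChange ws σ

theorem signChange_nil_right (ws : List (α → ZMod 2)) : signChange ws [] = 0 := by
  cases ws <;> rfl

theorem coboundary_signChange (ws : List (α → ZMod 2)) (σ : List α) :
    coboundary (signChange ws) σ = 0 := by
  cases ws <;> exact coboundary_coboundary _ _

theorem signChange_cons_cons (w : α → ZMod 2) (ws : List (α → ZMod 2)) (v : α) (l : List α) :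
    signChange (w :: ws) (v :: l) = (l.head?.elim 0 w + w v) * signChange ws l := by
  have h := coboundary_signChange ws (v :: l)
  rw [coboundary, CharTwo.add_eq_zero] at h
  simp only [signChange, coboundary, List.head?_cons, Option.elim_some]
  rw [coboundary_const_mul, ← h]
  ring

theorem exists_ne_of_signChange_ne_zero {ws : List (α → ZMod 2)} {σ : List α}
    (h : signChange ws σ ≠ 0) : ∀ w ∈ ws, ∃ v ∈ σ, ∃ v' ∈ σ, w v ≠ w v' := by
  induction ws generalizing σ with
  | nil => simp
  | cons w ws ih =>
    match σ, h with
    | [], h => exact absurd (signChange_nil_right _) h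
    | [v], h => simp [signChange_cons_cons, signChange_nil_right] at h
    | v :: v' :: l, h =>
      rw [signChange_cons_cons] at h
      have h2 := ih (right_ne_zero_of_mul h)
      have h1 := left_ne_zero_of_mul h
      simp only [List.head?_cons, Option.elim_some, ne_eq, CharTwo.add_eq_zero] at h1
      intro u hu
      rcases List.mem_cons.1 hu with rfl | hu
      · exact ⟨v', by simp, v, by simp, h1⟩
      · obtain ⟨x, hx, y, hy, hxy⟩ := h2 u hu
        exact ⟨x, List.mem_cons_of_mem _ hx, y, List.mem_cons_of_mem _ hy, hxy⟩

theorem signChange_map {g : α → α} {ws : List (α → ZMod 2)} {σ : List α}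
    (h : ∀ w ∈ ws, ∀ v ∈ σ, w (g v) = w v + 1) :
    signChange ws (σ.map g) = signChange ws σ := by
  induction ws generalizing σ with
  | nil => simp [signChange, coboundary_map]
  | cons w ws ih =>
    match σ, h with
    | [], h => rfl
    | [v], h => simp [signChange_cons_cons, signChange_nil_right]
    | v :: v' :: l, h =>
      have h1 := ih (σ := v' :: l) fun w hw u hu =>
        h w (List.mem_cons_of_mem _ hw) u (List.mem_cons_of_mem _ hu)
      rw [List.map_cons, signChange_cons_cons, signChange_cons_cons, h1]
      congr 1
      simp only [List.map_cons, List.head?_cons, Option.elim_some]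
      rw [h w (by simp) v (by simp), h w (by simp) v' (by simp)]
      have := CharTwo.add_self_eq_zero (1 : ZMod 2)
      linear_combination this

end Coboundary

/-! ### The hemispheres of the cross-polytope -/

section CrossPolytope

variable {E : Type*}

/-- Evaluation of a cochain on the `k`-dimensional hemisphere of the boundary of the cross-polytope
with vertices `± e i`, obtained by coning the `(k - 1)`-dimensional sphere from `e k`. -/
def hemisphere [Neg E] (e : ℕ → E) : ℕ → (List E → ZMod 2) → ZMod 2
  | 0, φ => φ [e 0]
  | k + 1, φ => hemisphere e k (fun τ => φ (e (k + 1) :: τ)) +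
      hemisphere e k (fun τ => φ (e (k + 1) :: τ.map Neg.neg))

theorem hemisphere_add [Neg E] (e : ℕ → E) (k : ℕ) (φ ψ : List E → ZMod 2) :
    hemisphere e k (fun τ => φ τ + ψ τ) = hemisphere e k φ + hemisphere e k ψ := by
  induction k generalizing φ ψ with
  | zero => rfl
  | succ k ih => simp only [hemisphere, ih]; ring

theorem hemisphere_coboundary [InvolutiveNeg E] (e : ℕ → E) (k : ℕ) (φ : List E → ZMod 2) :
    hemisphere e (k + 1) (coboundary φ) =
      hemisphere e k φ + hemisphere e k (fun τ => φ (τ.map Neg.neg)) := by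
  induction k generalizing φ with
  | zero =>
    have := CharTwo.add_self_eq_zero (φ [e 1])
    simp only [hemisphere, coboundary, List.map_cons, List.map_nil]
    linear_combination this
  | succ k ih =>
    rw [hemisphere]
    simp only [coboundary, coboundary_map, hemisphere_add]
    rw [ih, ih]
    simp only [List.map_map, neg_involutive.comp_self, List.map_id]
    generalize hemisphere e k _ = a
    generalize hemisphere e k _ = b
    have := CharTwo.add_self_eq_zero (a + b)
    linear_combination this

/-- The vertices of the face of the cross-polytope with signs `ε`. -/
def faceVertices [SMul ℝ E] (e : ℕ → E) (ε : ℕ → ℝ) (k : ℕ) : Set E :=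
  {x | ∃ i ≤ k, x = ε i • e i}

theorem hemisphere_eq_zero [AddCommGroup E] [Module ℝ E] (e : ℕ → E) (k : ℕ)
    (φ : List E → ZMod 2)
    (h : ∀ ε : ℕ → ℝ, (∀ i, ε i = 1 ∨ ε i = -1) → ∀ τ : List E, τ.length = k + 1 →
      (∀ x ∈ τ, x ∈ faceVertices e ε k) → φ τ = 0) :
    hemisphere e k φ = 0 := by
  induction k generalizing φ with
  | zero =>
    refine h (fun _ => 1) (by simp) _ (by simp) ?_
    simp [faceVertices]
  | succ k ih =>
    have key : ∀ ε : ℕ → ℝ, (∀ i, ε i = 1 ∨ ε i = -1) → ∀ τ : List E, τ.length = k + 1 →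
        (∀ x ∈ τ, x ∈ faceVertices e ε k) → φ (e (k + 1) :: τ) = 0 := by
      intro ε hε τ hl hτ
      refine h (Function.update ε (k + 1) 1) ?_ _ (by simp [hl]) ?_
      · intro i
        by_cases hi : i = k + 1
        · simp [hi]
        · simpa [Function.update_of_ne hi] using hε i
      · intro x hx
        rcases List.mem_cons.1 hx with rfl | hx
        · exact ⟨k + 1, le_rfl, by simp⟩
        · obtain ⟨i, hi, rfl⟩ := hτ x hx
          exact ⟨i, by omega, by rw [Function.update_of_ne (by omega)]⟩
    rw [hemisphere, ih _ key, ih, add_zero]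
    intro ε hε τ hl hτ
    refine key (fun i => -ε i) (fun i => ?_) _ (by simpa using hl) ?_
    · rcases hε i with h | h <;> simp [h]
    · intro x hx
      obtain ⟨y, hy, rfl⟩ := List.mem_map.1 hx
      obtain ⟨i, hi, rfl⟩ := hτ y hy
      exact ⟨i, hi, by simp⟩

end CrossPolytope

/-! ### Mesh of barycentric subdivisions -/

section Mesh

variable {E : Type*} [NormedAddCommGroup E] [NormedSpace ℝ E]

/-- The barycenter of a list of points. -/
noncomputable def listBarycenter (σ : List E) : E :=
  (σ.length : ℝ)⁻¹ • σ.sum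

theorem listBarycenter_map_neg (σ : List E) :
    listBarycenter (σ.map Neg.neg) = -listBarycenter σ := by
  have : (σ.map Neg.neg).sum = -σ.sum := by
    induction σ with
    | nil => simp
    | cons v l ih => simp [ih, add_comm]
  simp [listBarycenter, this]

theorem listBarycenter_mem {Q : Set E} (hQ : Convex ℝ Q) {σ : List E} (h0 : σ ≠ [])
    (h : ∀ x ∈ σ, x ∈ Q) : listBarycenter σ ∈ Q := by
  have hl : (σ.length : ℝ) ≠ 0 := by simpa using h0
  have := hQ.sum_mem (t := Finset.univ) (w := fun _ : Fin σ.length => (σ.length : ℝ)⁻¹)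
    (z := fun i => σ.get i) (fun _ _ => by positivity) (by simp [hl]) (fun i _ => h _ (by simp))
  rw [← Finset.smul_sum] at this
  rw [listBarycenter]
  convert this
  simp [← List.sum_ofFn]

theorem dist_listBarycenter_le {σ : List E} {d : ℝ}
    (h : ∀ x ∈ σ, ∀ y ∈ σ, dist x y ≤ d) {v : E} (hv : v ∈ σ) :
    dist v (listBarycenter σ) ≤ ((σ.length - 1 : ℝ) / σ.length) * d := by
  classical
  have hl : (0 : ℝ) < σ.length := by exact_mod_cast List.length_pos_of_mem hv
  have key : ∀ l : List E, (∀ x ∈ l, dist v x ≤ d) →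
      ‖(l.length : ℝ) • v - l.sum‖ ≤ l.length * d := by
    intro l hd
    induction l with
    | nil => simp
    | cons a l ih =>
      have h1 := ih fun x hx => hd x (List.mem_cons_of_mem _ hx)
      have h2 := hd a (by simp)
      rw [dist_eq_norm] at h2
      have : ((a :: l).length : ℝ) • v - (a :: l).sum =
          (v - a) + ((l.length : ℝ) • v - l.sum) := by
        simp only [List.length_cons, List.sum_cons, Nat.cast_add, Nat.cast_one, add_smul, one_smul]
        abel
      rw [this]
      refine (norm_add_le _ _).trans ?_
      simp only [List.length_cons, Nat.cast_add, Nat.cast_one]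
      linarith
  have hp := List.perm_cons_erase hv
  have hs : σ.sum = v + (σ.erase v).sum := by simpa using hp.sum_eq
  have hlen : (σ.length : ℝ) = (σ.erase v).length + 1 := by
    exact_mod_cast (by simpa using hp.length_eq : σ.length = (σ.erase v).length + 1)
  have h3 := key (σ.erase v) fun x hx => h v hv x (List.mem_of_mem_erase hx)
  have h4 : v - listBarycenter σ =
      (σ.length : ℝ)⁻¹ • (((σ.erase v).length : ℝ) • v - (σ.erase v).sum) := by
    have : ((σ.erase v).length : ℝ) • v - (σ.erase v).sum = (σ.length : ℝ) • v - σ.sum := by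
      rw [hs, hlen, add_smul, one_smul]; abel
    rw [this, smul_sub, smul_smul, inv_mul_cancel₀ hl.ne', one_smul, listBarycenter]
  rw [dist_eq_norm, h4, norm_smul, norm_inv, Real.norm_of_nonneg hl.le]
  have h5 : (σ.length : ℝ) - 1 = (σ.erase v).length := by rw [hlen]; ring
  rw [h5, div_mul_eq_mul_div, div_eq_inv_mul]
  gcongr

theorem subdivisionAux_eq_zero {c d : ℝ} (hd : 0 ≤ d) {Q : Set E} (hQ : Convex ℝ Q) (k : ℕ)
    (hc : ∀ j : ℕ, j < k → (j : ℝ) / (j + 1) ≤ c) (φ : List E → ZMod 2) (σ : List E)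
    (hl : σ.length = k) (hσ : ∀ x ∈ σ, x ∈ Q) (hdiam : ∀ x ∈ σ, ∀ y ∈ σ, dist x y ≤ d)
    (hφ : ∀ τ : List E, τ.length = k → (∀ x ∈ τ, x ∈ Q) →
      (∀ x ∈ τ, ∀ y ∈ τ, dist x y ≤ c * d) → φ τ = 0) :
    subdivisionAux listBarycenter k φ σ = 0 := by
  induction k generalizing φ σ Q with
  | zero =>
    refine hφ σ hl hσ fun x hx => ?_
    simp [List.length_eq_zero_iff.1 hl] at hx
  | succ k ih =>
    have hne : σ ≠ [] := by rintro rfl; simp at hl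
    have hc0 : 0 ≤ c := le_trans (by positivity) (hc k (by omega))
    set H := convexHull ℝ {x | x ∈ σ}
    have hHQ : H ⊆ Q := convexHull_min hσ hQ
    have hbH : listBarycenter σ ∈ H :=
      listBarycenter_mem (convex_convexHull ℝ _) hne fun x hx => subset_convexHull ℝ _ hx
    have hball : H ⊆ Metric.closedBall (listBarycenter σ) (c * d) := by
      refine convexHull_min (fun x hx => ?_) (convex_closedBall _ _)
      refine (dist_listBarycenter_le hdiam hx).trans ?_
      have := hc k (by omega)
      rw [hl]
      push_cast
      rw [add_sub_cancel_right]
      gcongr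
    rw [subdivisionAux, ← coboundary_zero σ]
    refine coboundary_congr fun ρ hρ hlρ => ?_
    refine ih (convex_convexHull ℝ {x | x ∈ σ}) (fun j hj => hc j (by omega)) _ ρ (by omega)
      (fun x hx => subset_convexHull ℝ _ (hρ.subset hx))
      (fun x hx y hy => hdiam x (hρ.subset hx) y (hρ.subset hy)) ?_
    intro τ hlτ hτ hdτ
    refine hφ _ (by simp [hlτ]) ?_ ?_
    · intro x hx
      rcases List.mem_cons.1 hx with rfl | hx
      · exact hHQ hbH
      · exact hHQ (hτ x hx)
    · intro x hx y hy
      rcases List.mem_cons.1 hx with rfl | hx <;> rcases List.mem_cons.1 hy with rfl | hy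
      · rw [dist_self]; positivity
      · rw [dist_comm]; exact hball (hτ y hy)
      · exact hball (hτ x hx)
      · exact hdτ x hx y hy

theorem iterate_subdivision_eq_zero {c : ℝ} {Q : Set E} (hQ : Convex ℝ Q) (k : ℕ) (hc0 : 0 ≤ c)
    (hc : ∀ j : ℕ, j < k → (j : ℝ) / (j + 1) ≤ c) (m : ℕ) {d : ℝ} (hd : 0 ≤ d)
    (φ : List E → ZMod 2) (σ : List E)
    (hl : σ.length = k) (hσ : ∀ x ∈ σ, x ∈ Q) (hdiam : ∀ x ∈ σ, ∀ y ∈ σ, dist x y ≤ d)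
    (hφ : ∀ τ : List E, τ.length = k → (∀ x ∈ τ, x ∈ Q) →
      (∀ x ∈ τ, ∀ y ∈ τ, dist x y ≤ c ^ m * d) → φ τ = 0) :
    (subdivision listBarycenter)^[m] φ σ = 0 := by
  induction m generalizing d σ with
  | zero => exact hφ σ hl hσ (by simpa using hdiam)
  | succ m ih =>
    rw [Function.iterate_succ_apply', subdivision, hl]
    refine subdivisionAux_eq_zero hd hQ k hc _ σ hl hσ hdiam fun τ h1 h2 h3 => ?_
    refine ih (mul_nonneg hc0 hd) τ h1 h2 h3 fun ρ h4 h5 h6 => hφ ρ h4 h5 fun x hx y hy => ?_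
    exact (h6 x hx y hy).trans_eq (by ring)

theorem hemisphere_iterate_subdivision_eq_zero {c d : ℝ} {e : ℕ → E} (k : ℕ) (hc0 : 0 ≤ c)
    (hc : ∀ j : ℕ, j ≤ k → (j : ℝ) / (j + 1) ≤ c) (m : ℕ) (hd : 0 ≤ d)
    (he : ∀ i, ‖e i‖ ≤ d / 2) (φ : List E → ZMod 2)
    (hφ : ∀ ε : ℕ → ℝ, (∀ i, ε i = 1 ∨ ε i = -1) → ∀ τ : List E, τ.length = k + 1 →
      (∀ x ∈ τ, x ∈ convexHull ℝ (faceVertices e ε k)) →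
      (∀ x ∈ τ, ∀ y ∈ τ, dist x y ≤ c ^ m * d) → φ τ = 0) :
    hemisphere e k ((subdivision listBarycenter)^[m] φ) = 0 := by
  refine hemisphere_eq_zero e k _ fun ε hε τ hl hτ => ?_
  have hnorm : ∀ x ∈ τ, ‖x‖ ≤ d / 2 := by
    intro x hx
    obtain ⟨i, -, rfl⟩ := hτ x hx
    rcases hε i with h | h <;> simpa [h] using he i
  refine iterate_subdivision_eq_zero (convex_convexHull ℝ (faceVertices e ε k)) (k + 1) hc0
    (fun j hj => hc j (by omega)) m hd φ τ hl (fun x hx => subset_convexHull ℝ _ (hτ x hx))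
    (fun x hx y hy => ?_) (hφ ε hε)
  rw [dist_eq_norm]
  have := norm_sub_le x y
  linarith [hnorm x hx, hnorm y hy]

/-- If all labelings are antipodal on the sphere spanned by the `± e i`, then they change sign an
odd number of times, counted in the sense of `signChange`. -/
theorem hemisphere_iterate_subdivision_signChange {c d : ℝ} {e : ℕ → E} (hc0 : 0 ≤ c) (m : ℕ)
    (hd : 0 ≤ d) (he : ∀ i, ‖e i‖ ≤ d / 2) (ws : List (E → ZMod 2))
    (hc : ∀ j : ℕ, j ≤ ws.length → (j : ℝ) / (j + 1) ≤ c)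
    (hw : ∀ w ∈ ws, ∀ ε : ℕ → ℝ, (∀ i, ε i = 1 ∨ ε i = -1) →
      ∀ v ∈ convexHull ℝ (faceVertices e ε ws.length), w (-v) = w v + 1) :
    hemisphere e ws.length ((subdivision listBarycenter)^[m] (signChange ws)) = 1 := by
  induction ws with
  | nil =>
    rw [List.length_nil, hemisphere, iterate_subdivision_singleton (by simp [listBarycenter])]
    simp [signChange, coboundary]
  | cons w ws ih =>
    have hsub : ∀ ε : ℕ → ℝ, convexHull ℝ (faceVertices e ε ws.length) ⊆
        convexHull ℝ (faceVertices e ε (ws.length + 1)) := fun ε =>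
      convexHull_mono fun x ⟨i, hi, hx⟩ => ⟨i, by omega, hx⟩
    have h1 := ih (fun j hj => hc j (by simp; omega)) fun u hu ε hε v hv =>
      hw u (List.mem_cons_of_mem _ hu) ε hε v (hsub ε hv)
    rw [List.length_cons, signChange, iterate_subdivision_coboundary, hemisphere_coboundary]
    have h2 := iterate_subdivision_map (b := listBarycenter (E := E)) (g := Neg.neg)
      listBarycenter_map_neg m (fun σ => σ.head?.elim 0 w * signChange ws σ)
    rw [← h2, ← h1, ← CharTwo.add_eq_zero, ← hemisphere_add, ← hemisphere_add]
    change hemisphere e ws.length (_ + _ + _) = 0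
    rw [← iterate_subdivision_add, ← iterate_subdivision_add]
    refine hemisphere_iterate_subdivision_eq_zero ws.length hc0
      (fun j hj => hc j (by simp; omega)) m hd he _ fun ε hε τ hl hτ _ => ?_
    match τ, hl, hτ with
    | v :: l, hl, hτ =>
      have h3 : signChange ws ((v :: l).map Neg.neg) = signChange ws (v :: l) :=
        signChange_map fun u hu x hx =>
          hw u (List.mem_cons_of_mem _ hu) ε hε x (hsub ε (hτ x hx))
      have h4 := hw w (by simp) ε hε v (hsub ε (hτ v (by simp)))
      simp only [Pi.add_apply, h3]
      simp only [List.map_cons, List.head?_cons, Option.elim_some, h4]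
      have h5 := CharTwo.add_self_eq_zero (w v * signChange ws (v :: l))
      have h6 := CharTwo.add_self_eq_zero (signChange ws (v :: l))
      linear_combination h5 + h6

end Mesh

/-! ### The Borsuk-Ulam theorem and interval selection -/

theorem exists_antipodal_selection (n : ℕ) :
    ∃ P : (Fin n → ℝ) → Prop, ∀ v, v ≠ 0 → (P (-v) ↔ ¬ P v) := by
  refine ⟨fun v => 0 < toLex v, fun v hv => ?_⟩
  have h0 : toLex v ≠ 0 := hv
  change 0 < toLex (-v) ↔ ¬ 0 < toLex v
  have h1 : toLex (-v) = -toLex v := rfl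
  rw [h1, Left.neg_pos_iff]
  exact ⟨fun h h' => lt_asymm h h', fun h => (lt_or_gt_of_ne h0).resolve_right h⟩

theorem sum_abs_eq_one_of_mem_convexHull {n : ℕ} {ε : ℕ → ℝ} (hε : ∀ i, ε i = 1 ∨ ε i = -1)
    {v : Fin (n + 1) → ℝ}
    (hv : v ∈ convexHull ℝ (faceVertices (fun i (j : Fin (n + 1)) => if (j : ℕ) = i then 1 else 0)
      ε n)) : ∑ i, |v i| = 1 := by
  have hsq : ∀ i, ε i * ε i = 1 := fun i => by rcases hε i with h | h <;> simp [h]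
  have hQ : Convex ℝ {x : Fin (n + 1) → ℝ | (∀ j : Fin (n + 1), 0 ≤ ε j * x j) ∧
      ∑ j : Fin (n + 1), ε j * x j = 1} := by
    intro x hx y hy a b ha hb hab
    have heq : ∀ j : Fin (n + 1), ε j * (a • x + b • y) j = a * (ε j * x j) + b * (ε j * y j) := by
      intro j
      simp only [Pi.add_apply, Pi.smul_apply, smul_eq_mul]; ring
    refine ⟨fun j => ?_, ?_⟩
    · rw [heq]
      exact add_nonneg (mul_nonneg ha (hx.1 j)) (mul_nonneg hb (hy.1 j))
    · simp only [heq]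
      rw [Finset.sum_add_distrib, ← Finset.mul_sum, ← Finset.mul_sum, hx.2, hy.2]
      linarith
  have hmem := convexHull_min (t := {x : Fin (n + 1) → ℝ | (∀ j : Fin (n + 1), 0 ≤ ε j * x j) ∧
    ∑ j : Fin (n + 1), ε j * x j = 1}) ?_ hQ hv
  · rw [← hmem.2]
    refine Finset.sum_congr rfl fun j _ => ?_
    have h := abs_of_nonneg (hmem.1 j)
    rw [abs_mul] at h
    rw [← h]
    rcases hε j with h | h <;> simp [h]
  · rintro x ⟨i, hi, rfl⟩
    refine ⟨fun j => ?_, ?_⟩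
    · by_cases h : (j : ℕ) = i
      · simp [h, hsq]
      · simp [h]
    · rw [Finset.sum_eq_single (⟨i, by omega⟩ : Fin (n + 1))]
      · simp [hsq]
      · intro j _ hj
        have : (j : ℕ) ≠ i := fun h => hj (Fin.ext h)
        simp [this]
      · simp

/-- The **Borsuk-Ulam theorem**, on the boundary of the cross-polytope. -/
theorem exists_eq_zero_of_odd {n : ℕ} {f : (Fin (n + 1) → ℝ) → Fin n → ℝ} (hf : Continuous f)
    (hodd : ∀ x, f (-x) = -f x) : ∃ x, ∑ i, |x i| = 1 ∧ f x = 0 := by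
  classical
  by_contra! hne
  set K : Set (Fin (n + 1) → ℝ) := {x | ∑ i, |x i| = 1} with hK
  have hKc : IsCompact K := by
    refine Metric.isCompact_of_isClosed_isBounded (isClosed_eq (by fun_prop) continuous_const) ?_
    refine (Metric.isBounded_closedBall (x := (0 : Fin (n + 1) → ℝ)) (r := 1)).subset fun x hx => ?_
    rw [mem_closedBall_zero_iff, pi_norm_le_iff_of_nonneg zero_le_one]
    intro i
    rw [← show ∑ i, |x i| = 1 from hx, Real.norm_eq_abs]
    exact Finset.single_le_sum (f := fun i => |x i|) (fun i _ => abs_nonneg _) (Finset.mem_univ i)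
  have hK0 : ∀ x ∈ K, x ≠ 0 := by rintro x hx rfl; simp [hK] at hx
  obtain ⟨δ, hδ, hfδ⟩ : ∃ δ > 0, ∀ x ∈ K, δ ≤ ‖f x‖ := by
    have hKn : K.Nonempty := ⟨Pi.single 0 1, by
      simp only [hK, Set.mem_ofPred_eq]
      rw [Finset.sum_eq_single 0] <;> simp +contextual⟩
    obtain ⟨x, hx, hmin⟩ := hKc.exists_isMinOn hKn hf.norm.continuousOn
    exact ⟨‖f x‖, norm_pos_iff.2 (hne x hx), fun y hy => hmin hy⟩
  obtain ⟨η, hη, huc⟩ := Metric.uniformContinuousOn_iff.1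
    (hKc.uniformContinuousOn_of_continuous hf.continuousOn) δ hδ
  set c : ℝ := (n : ℝ) / (n + 1) with hcdef
  have hc0 : 0 ≤ c := by positivity
  have hc1 : c < 1 := by rw [hcdef, div_lt_one (by positivity)]; linarith
  obtain ⟨m, hm⟩ := exists_pow_lt_of_lt_one (half_pos hη) hc1
  obtain ⟨P, hP⟩ := exists_antipodal_selection (n + 1)
  set w : Fin n → (Fin (n + 1) → ℝ) → ZMod 2 := fun i v =>
    if 0 < f v i ∨ f v i = 0 ∧ P v then 1 else 0 with hw
  have hwneg : ∀ i, ∀ v ∈ K, w i (-v) = w i v + 1 := by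
    intro i v hv
    have h1 := hP v (hK0 v hv)
    have h2 : (1 : ZMod 2) + 1 = 0 := by decide
    simp only [hw, hodd, Pi.neg_apply, h1, neg_eq_zero, Left.neg_pos_iff]
    rcases lt_trichotomy (f v i) 0 with h | h | h
    · simp [h, h.ne, h.not_gt]
    · by_cases hPv : P v <;> simp [h, hPv, h2]
    · simp [h, h.ne', h.not_gt, h2]
  set e : ℕ → Fin (n + 1) → ℝ := fun i j => if (j : ℕ) = i then 1 else 0 with he
  have hnorm : ∀ i, ‖e i‖ ≤ 2 / 2 := by
    intro i
    rw [pi_norm_le_iff_of_nonneg (by norm_num)]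
    intro j
    simp only [he]
    split_ifs <;> simp
  have hcj : ∀ j : ℕ, j ≤ n → (j : ℝ) / (j + 1) ≤ c := by
    intro j hj
    have : (j : ℝ) ≤ n := by exact_mod_cast hj
    rw [hcdef, div_le_div_iff₀ (by positivity) (by positivity)]
    linarith
  have hlen : (List.ofFn w).length = n := List.length_ofFn
  have hone := hemisphere_iterate_subdivision_signChange (e := e) hc0 m zero_le_two hnorm
    (List.ofFn w) (by rwa [hlen]) (by
      intro u hu ε hε v hv
      obtain ⟨i, rfl⟩ := (List.mem_ofFn' w u).1 hu
      rw [hlen] at hv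
      exact hwneg i v (sum_abs_eq_one_of_mem_convexHull hε hv))
  refine one_ne_zero (hone.symm.trans ?_)
  rw [hlen]
  refine hemisphere_iterate_subdivision_eq_zero n hc0 hcj m zero_le_two hnorm _
    fun ε hε τ hl hτ hmesh => ?_
  by_contra hsc
  have hτK : ∀ x ∈ τ, x ∈ K := fun x hx => sum_abs_eq_one_of_mem_convexHull hε (hτ x hx)
  have hclose : ∀ x ∈ τ, ∀ y ∈ τ, ∀ i, |f x i - f y i| < δ := by
    intro x hx y hy i
    have h1 := huc x (hτK x hx) y (hτK y hy) (by linarith [hmesh x hx y hy])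
    rw [← Real.dist_eq]
    exact (dist_le_pi_dist (f x) (f y) i).trans_lt h1
  obtain ⟨x, hx⟩ := List.exists_mem_of_length_pos (l := τ) (by omega)
  refine (hfδ x (hτK x hx)).not_gt ((pi_norm_lt_iff hδ).2 fun i => ?_)
  obtain ⟨v, hv, v', hv', hvv⟩ := exists_ne_of_signChange_ne_zero hsc (w i)
    ((List.mem_ofFn' w _).2 ⟨i, rfl⟩)
  have hsign : 0 ≤ f v i ∧ f v' i ≤ 0 ∨ 0 ≤ f v' i ∧ f v i ≤ 0 := by
    by_contra hcon
    refine hvv ?_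
    simp only [hw]
    rcases le_total 0 (f v i) with h | h <;> rcases le_total 0 (f v' i) with h' | h'
    · rw [if_pos (Or.inl (by grind)), if_pos (Or.inl (by grind))]
    · grind
    · grind
    · rw [if_neg (by grind), if_neg (by grind)]
  have h1 := abs_lt.1 (hclose x hx v hv i)
  have h2 := abs_lt.1 (hclose x hx v' hv' i)
  rw [Real.norm_eq_abs, abs_lt]
  rcases hsign with h | h <;> constructor <;> linarith [h.1, h.2, h1.1, h1.2, h2.1, h2.2]

/-- A curve in an `n`-dimensional space admits a division of its domain into `n + 1` consecutive
intervals, some of which carry exactly half of the total increment. -/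
theorem exists_halving_division {V : Type*} [NormedAddCommGroup V] [NormedSpace ℝ V]
    [FiniteDimensional ℝ V] {g : ℝ → V} (hg : Continuous g) {n : ℕ}
    (hn : Module.finrank ℝ V = n) :
    ∃ p : ℕ → ℝ, Monotone p ∧ p 0 = 0 ∧ p (n + 1) = 1 ∧ ∃ A : Finset (Fin (n + 1)),
      ∑ i ∈ A, (g (p (i + 1)) - g (p i)) = ∑ i ∈ Aᶜ, (g (p (i + 1)) - g (p i)) := by
  subst hn
  set n := Module.finrank ℝ V
  set q : (Fin (n + 1) → ℝ) → ℕ → ℝ := fun x k =>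
    ∑ j ∈ Finset.univ.filter fun j : Fin (n + 1) => (j : ℕ) < k, |x j| with hq
  set F : (Fin (n + 1) → ℝ) → V := fun x =>
    ∑ i : Fin (n + 1), (g (q x i + max (x i) 0) - g (q x i + max (-x i) 0)) with hF
  have hFc : Continuous F := by fun_prop
  have hFodd : ∀ x, F (-x) = -F x := by
    intro x
    simp [hF, hq]
  set L := (Module.finBasis ℝ V).equivFunL
  obtain ⟨x, hx, hx0⟩ := exists_eq_zero_of_odd (f := fun x => L (F x))
    (L.continuous.comp hFc) (by simp [hFodd])
  have hFx : F x = 0 := by simpa using hx0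
  have hsucc : ∀ i : Fin (n + 1), q x (i + 1) = q x i + |x i| := by
    intro i
    have : ({j : Fin (n + 1) | (j : ℕ) < i + 1} : Finset _) =
        insert i ({j : Fin (n + 1) | (j : ℕ) < i} : Finset _) := by
      ext j
      simp [Fin.ext_iff]
      omega
    simp only [hq]
    rw [this, Finset.sum_insert (by simp), add_comm]
  refine ⟨q x, fun a b hab => ?_, by simp [hq], ?_, ({i | 0 ≤ x i} : Finset _), ?_⟩
  · refine Finset.sum_le_sum_of_subset_of_nonneg (fun j hj => ?_) fun j _ _ => abs_nonneg _
    simp only [Finset.mem_filter, Finset.mem_univ, true_and] at hj ⊢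
    omega
  · simp only [hq]
    rw [Finset.filter_true_of_mem fun j _ => j.2, hx]
  · rw [hF] at hFx
    simp only at hFx
    rw [← Finset.sum_add_sum_compl ({i | 0 ≤ x i} : Finset _)] at hFx
    rw [← sub_eq_zero, ← hFx, sub_eq_add_neg, ← Finset.sum_neg_distrib]
    congr 1 <;> refine Finset.sum_congr rfl fun i hi => ?_
    · have hi : 0 ≤ x i := by simpa using hi
      rw [hsucc, abs_of_nonneg hi, max_eq_left hi, max_eq_right (by linarith), add_zero]
    · have hi : x i < 0 := by simpa using hi
      rw [hsucc, abs_of_neg hi, max_eq_right hi.le, max_eq_left (by linarith), add_zero, neg_sub]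

/-- Burago's interval selection lemma: for a continuous curve `γ : [s,t] → V` in an
`n`-dimensional normed space, there are at most `⌈n/2⌉` essentially disjoint subintervals
whose endpoint differences sum to half the total difference `γ(t) - γ(s)`. -/
theorem burago_interval_selection
    {V : Type*} [NormedAddCommGroup V] [NormedSpace ℝ V] [FiniteDimensional ℝ V]
    (hn : 1 ≤ Module.finrank ℝ V)
    (s t : ℝ) (hst : s < t) (γ : ℝ → V) (hγ : ContinuousOn γ (Set.Icc s t)) :
    ∃ k : ℕ, 1 ≤ k ∧ k ≤ ⌈(Module.finrank ℝ V : ℝ) / 2⌉₊ ∧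
      ∃ a b : Fin k → ℝ,
        (∀ i, s ≤ a i) ∧ (∀ i, a i ≤ b i) ∧
        (∀ i j : Fin k, i < j → b i ≤ a j) ∧ (∀ i, b i ≤ t) ∧
        ∑ i, (γ (b i) - γ (a i)) = (1 / 2 : ℝ) • (γ t - γ s) := by
  set n := Module.finrank ℝ V with hndef
  obtain ⟨g, hgc, hgγ⟩ : ∃ g : ℝ → V, Continuous g ∧ ∀ y ∈ Set.Icc s t, g y = γ y :=
    ⟨_, hγ.domRestrict.Icc_extend' (h := hst.le), fun y hy => by
      rw [Set.IccExtend_of_mem _ _ hy, Set.domRestrict_apply]⟩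
  obtain ⟨p, hp, hp0, hp1, A, hA⟩ := exists_halving_division
    (g := fun u => g (s + (t - s) * u)) (by fun_prop) hndef.symm
  set T : ℕ → ℝ := fun k => s + (t - s) * p (min k (n + 1)) with hT
  have hTm : Monotone T := fun a b hab => by
    have := hp (min_le_min_right (n + 1) hab)
    have h : 0 ≤ t - s := by linarith
    simp only [hT]
    gcongr
  have hT0 : T 0 = s := by simp [hT, hp0]
  have hT1 : T (n + 1) = t := by simp [hT, hp1]
  have hTs : ∀ k, s ≤ T k := fun k => hT0 ▸ hTm (Nat.zero_le k)
  have hTt : ∀ k, T k ≤ t := fun k => by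
    rcases le_total k (n + 1) with h | h
    · exact hT1 ▸ hTm h
    · simp [hT, h, hp1]
  have hgT : ∀ k ≤ n + 1, g (s + (t - s) * p k) = γ (T k) := fun k hk => by
    have h : s + (t - s) * p k = T k := by simp [hT, hk]
    rw [h, hgγ _ ⟨hTs k, hTt k⟩]
  have hsum : ∀ S : Finset (Fin (n + 1)),
      ∑ i ∈ S, (g (s + (t - s) * p (i + 1)) - g (s + (t - s) * p i)) =
        ∑ i ∈ S, (γ (T (i + 1)) - γ (T i)) := fun S => Finset.sum_congr rfl fun i _ => by
    rw [hgT _ (by omega), hgT _ (by omega)]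
  rw [hsum, hsum] at hA
  have htot : ∑ i ∈ A, (γ (T (i + 1)) - γ (T i)) + ∑ i ∈ Aᶜ, (γ (T (i + 1)) - γ (T i)) =
      γ t - γ s := by
    rw [Finset.sum_add_sum_compl,
      Fin.sum_univ_eq_sum_range (fun i => γ (T (i + 1)) - γ (T i)) (n + 1),
      Finset.sum_range_sub (fun i => γ (T i)), hT0, hT1]
  have hcard := Finset.card_add_card_compl A
  rw [Fintype.card_fin] at hcard
  obtain ⟨S, hSc, hS⟩ : ∃ S : Finset (Fin (n + 1)), 2 * S.card ≤ n + 1 ∧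
      ∑ i ∈ S, (γ (T (i + 1)) - γ (T i)) = (1 / 2 : ℝ) • (γ t - γ s) := by
    rcases le_total A.card Aᶜ.card with h | h
    · refine ⟨A, by omega, ?_⟩
      rw [← htot, ← hA, ← two_smul ℝ, smul_smul]
      norm_num
    · refine ⟨Aᶜ, by omega, ?_⟩
      rw [← htot, hA, ← two_smul ℝ, smul_smul]
      norm_num
  have hceil : (n : ℝ) / 2 ≤ ⌈(n : ℝ) / 2⌉₊ := Nat.le_ceil _
  have hceil' : n ≤ 2 * ⌈(n : ℝ) / 2⌉₊ := by
    exact_mod_cast (by linarith : (n : ℝ) ≤ 2 * ⌈(n : ℝ) / 2⌉₊)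
  rcases S.eq_empty_or_nonempty with rfl | hne
  · refine ⟨1, le_rfl, by omega, fun _ => s, fun _ => s, fun _ => le_rfl, fun _ => le_rfl,
      fun _ _ _ => le_rfl, fun _ => hst.le, ?_⟩
    simpa using hS
  · refine ⟨S.card, hne.card_pos, by omega, fun i => T (S.orderEmbOfFin rfl i),
      fun i => T (S.orderEmbOfFin rfl i + 1), fun i => hTs _, fun i => hTm (Nat.le_succ _),
      fun i j hij => hTm ?_, fun i => hTt _, ?_⟩
    · have : S.orderEmbOfFin rfl i < S.orderEmbOfFin rfl j := (S.orderEmbOfFin rfl).strictMono hij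
      exact Nat.succ_le_of_lt this
    · rw [← hS, ← Finset.sum_coe_sort S]
      exact (S.orderIsoOfFin rfl).toEquiv.sum_comp
        fun i : S => γ (T ((i : Fin (n + 1)) + 1)) - γ (T (i : Fin (n + 1)))
end

section
/- Let b ≥ 1, let ‖·‖ be a norm on ℝ^b, let C ≥ 0, and let f : ℤ^b → ℝ be a nonnegative function satisfying: |f(h₁) − f(h₂)| ≤ ‖h₁ − h₂‖ + C for all h₁, h₂ ∈ ℤ^b; f(2h) ≤ 2f(h) and f(3h) ≤ 3f(h) for all h ∈ ℤ^b; and 2f(h) − f(2h) ≤ C for all h ∈ ℤ^b. Then there exists a function 𝔞 : ℤ^b → ℝ which is positively homogeneous of degree one, i.e. 𝔞(n·h) = n·𝔞(h) for all n ∈ ℕ and h ∈ ℤ^b, and which satisfies |f(h) − 𝔞(h)| ≤ 2C for every h ∈ ℤ^b. -/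
open Filter Topology

/-- Every positive real is a limit of numbers `3 ^ j * 2 ^ l / 2 ^ k` with `j k l` natural. -/
theorem exists_three_pow_mul_two_zpow_near {r ε : ℝ} (hr : 0 < r) (hε : 0 < ε) :
    ∃ j k l : ℕ, |(3 : ℝ) ^ j * 2 ^ l / 2 ^ k - r| < ε := by
  have : Fact (0 < Real.log 2) := ⟨Real.log_pos (by norm_num)⟩
  have hd : DenseRange (· • (Real.log 3 : AddCircle (Real.log 2)) : ℕ → AddCircle (Real.log 2)) :=
    denseRange_zsmul_iff_nsmul.mp
      (AddCircle.denseRange_zsmul_coe_iff.mpr irrational_log_three_div_log_two)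
  have hd' := QuotientAddGroup.dense_preimage_mk.mpr hd
  have hopen : IsOpen {x : ℝ | |Real.exp x - r| < ε} :=
    isOpen_lt (by fun_prop) continuous_const
  obtain ⟨x, hx, j, hj⟩ := hd'.inter_open_nonempty _ hopen
    ⟨Real.log r, by simpa [Real.exp_log hr] using hε⟩
  have hj' : ((j • Real.log 3 : ℝ) : AddCircle (Real.log 2)) = (x : AddCircle (Real.log 2)) := hj
  obtain ⟨z, hz⟩ := (QuotientAddGroup.eq_iff_sub_mem.mp hj'.symm)
  have hxz : x = j * Real.log 3 + z * Real.log 2 := by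
    simp only [zsmul_eq_mul, nsmul_eq_mul] at hz
    linarith
  refine ⟨j, (-z).toNat, z.toNat, ?_⟩
  have hzz : (z : ℝ) = (z.toNat : ℝ) - ((-z).toNat : ℝ) := by
    have : z = (z.toNat : ℤ) - ((-z).toNat : ℤ) := by omega
    exact_mod_cast this
  have hexp : Real.exp x = (3 : ℝ) ^ j * 2 ^ z.toNat / 2 ^ (-z).toNat := by
    rw [hxz, hzz, sub_mul, ← add_sub_assoc, Real.exp_sub, Real.exp_add, Real.exp_nat_mul,
      Real.exp_nat_mul, Real.exp_nat_mul, Real.exp_log (by norm_num), Real.exp_log (by norm_num)]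
  rw [← hexp]
  exact hx

/-- A nonnegative Lipschitz sequence that is homogeneous under doubling and subhomogeneous under
tripling is linear. -/
theorem eq_natCast_mul_of_double_of_triple_le {g : ℕ → ℝ} {L : ℝ} (hg : ∀ n, 0 ≤ g n)
    (hlip : ∀ p q : ℕ, |g p - g q| ≤ |(p : ℝ) - q| * L)
    (h2 : ∀ n, g (2 * n) = 2 * g n) (h3 : ∀ n, g (3 * n) ≤ 3 * g n) (n : ℕ) :
    g n = n * g 1 := by
  have hL : 0 ≤ L := by
    have := (abs_nonneg _).trans (hlip 1 0)
    simpa using this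
  have h2pow : ∀ k n : ℕ, g (2 ^ k * n) = 2 ^ k * g n := by
    intro k n
    induction k with
    | zero => simp
    | succ k ih => rw [pow_succ', mul_assoc, h2, ih, pow_succ', mul_assoc]
  have h3pow : ∀ k n : ℕ, g (3 ^ k * n) ≤ 3 ^ k * g n := by
    intro k n
    induction k with
    | zero => simp
    | succ k ih =>
      rw [pow_succ', mul_assoc, pow_succ', mul_assoc]
      exact (h3 _).trans (by gcongr)
  have key : ∀ m n : ℕ, 0 < m → 0 < n → g n ≤ n / m * g m := by
    intro m n hm hn
    have hm' : (0 : ℝ) < m := by exact_mod_cast hm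
    have hn' : (0 : ℝ) < n := by exact_mod_cast hn
    set K : ℝ := g m + m * L with hK
    have hbound : ∀ ε : ℝ, 0 < ε → g n ≤ n / m * g m + ε * K := by
      intro ε hε
      obtain ⟨j, k, l, h⟩ := exists_three_pow_mul_two_zpow_near (div_pos hn' hm') hε
      have hk : (0 : ℝ) < 2 ^ k := by positivity
      set t : ℝ := 3 ^ j * 2 ^ l / 2 ^ k with ht
      have ht' : (3 : ℝ) ^ j * 2 ^ l = 2 ^ k * t := by rw [ht]; field_simp
      have h1 := (abs_le.mp (hlip (2 ^ k * n) (3 ^ j * (2 ^ l * m)))).2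
      have hu : g (3 ^ j * (2 ^ l * m)) ≤ 2 ^ k * t * g m := by
        refine (h3pow _ _).trans_eq ?_
        rw [h2pow, ← ht', mul_assoc]
      have hd : |((2 ^ k * n : ℕ) : ℝ) - ((3 ^ j * (2 ^ l * m) : ℕ) : ℝ)| ≤ 2 ^ k * (m * ε) := by
        have : ((2 ^ k * n : ℕ) : ℝ) - ((3 ^ j * (2 ^ l * m) : ℕ) : ℝ)
            = -(2 ^ k * (m * (t - n / m))) := by
          push_cast
          rw [← mul_assoc, ht']
          field_simp
          ring
        rw [this, abs_neg, abs_mul, abs_mul, abs_of_pos hk, abs_of_pos hm']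
        gcongr
      rw [h2pow] at h1
      have htm : t * g m ≤ (n / m + ε) * g m :=
        mul_le_mul_of_nonneg_right (by linarith [(abs_lt.mp h).2]) (hg m)
      have hfin : 2 ^ k * g n ≤ 2 ^ k * (n / m * g m + ε * K) := by
        have e1 := mul_le_mul_of_nonneg_right hd hL
        have e2 := mul_le_mul_of_nonneg_left htm hk.le
        rw [hK]
        nlinarith
      exact le_of_mul_le_mul_left hfin hk
    have hK0 : 0 ≤ K := add_nonneg (hg m) (by positivity)
    refine le_of_forall_pos_le_add fun δ hδ => (hbound (δ / (K + 1)) (by positivity)).trans ?_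
    gcongr
    rw [div_mul_eq_mul_div, div_le_iff₀ (by positivity)]
    nlinarith
  rcases Nat.eq_zero_or_pos n with rfl | hn
  · have := h2 0
    simp only [mul_zero] at this
    simp only [CharP.cast_eq_zero, zero_mul]
    linarith
  · have hn' : (0 : ℝ) < n := by exact_mod_cast hn
    refine le_antisymm (by simpa using key 1 n one_pos hn) ?_
    have := key n 1 hn one_pos
    rw [Nat.cast_one, one_div_mul_eq_div, le_div_iff₀ hn'] at this
    linarith


/-- A nonnegative function on the lattice `ℤ^b` that is coarse-Lipschitz for a norm on
`ℝ^b` and almost homogeneous under doubling and tripling is within `2C` of a positively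
homogeneous function. -/
theorem lattice_function_almost_homogeneous
    (b : ℕ) (hb : 1 ≤ b)
    (nrm : (Fin b → ℝ) → ℝ)
    (nrm_eq_zero : ∀ x, nrm x = 0 ↔ x = 0)
    (nrm_smul : ∀ (c : ℝ) (x : Fin b → ℝ), nrm (c • x) = |c| * nrm x)
    (nrm_add : ∀ x y, nrm (x + y) ≤ nrm x + nrm y)
    (C : ℝ) (hC : 0 ≤ C)
    (f : (Fin b → ℤ) → ℝ) (hf0 : ∀ h, 0 ≤ f h)
    (hlip : ∀ h₁ h₂ : Fin b → ℤ,
      |f h₁ - f h₂| ≤ nrm (fun i => (h₁ i : ℝ) - (h₂ i : ℝ)) + C)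
    (hdouble : ∀ h, f ((2 : ℤ) • h) ≤ 2 * f h)
    (htriple : ∀ h, f ((3 : ℤ) • h) ≤ 3 * f h)
    (hdouble' : ∀ h, 2 * f h - f ((2 : ℤ) • h) ≤ C) :
    ∃ a : (Fin b → ℤ) → ℝ,
      (∀ (n : ℕ) (h : Fin b → ℤ), a (n • h) = (n : ℝ) * a h) ∧
      ∀ h, |f h - a h| ≤ 2 * C := by
  set u : (Fin b → ℤ) → ℕ → ℝ := fun h k => f ((2 ^ k : ℤ) • h) / 2 ^ k with hu
  have hu_succ : ∀ h k, u h (k + 1) ≤ u h k ∧ u h k - C / 2 ^ (k + 1) ≤ u h (k + 1) := by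
    intro h k
    have h1 := hdouble ((2 ^ k : ℤ) • h)
    have h2 := hdouble' ((2 ^ k : ℤ) • h)
    rw [smul_smul, ← pow_succ'] at h1 h2
    have hk : u h k = 2 * f ((2 ^ k : ℤ) • h) / 2 ^ (k + 1) := by
      simp only [hu, pow_succ']
      field_simp
    rw [hk, ← sub_div]
    simp only [hu]
    constructor <;> gcongr
    linarith
  have hanti : ∀ h, Antitone (u h) := fun h => antitone_nat_of_succ_le fun k => (hu_succ h k).1
  have hu0 : ∀ h, u h 0 = f h := by simp [hu]
  have hunonneg : ∀ h k, 0 ≤ u h k := fun h k => div_nonneg (hf0 _) (by positivity)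
  have hlow : ∀ h k, f h - C ≤ u h k := by
    intro h k
    have : f h - C + C / 2 ^ k ≤ u h k := by
      induction k with
      | zero => simp [hu0]
      | succ k ih =>
        have h1 := (hu_succ h k).2
        have h2 : C / 2 ^ k = C / 2 ^ (k + 1) + C / 2 ^ (k + 1) := by
          rw [pow_succ]
          field_simp
          norm_num
        linarith
    have : 0 ≤ C / 2 ^ k := by positivity
    linarith
  have hex : ∀ h, ∃ l, Tendsto (u h) atTop (𝓝 l) := fun h =>
    ⟨_, tendsto_atTop_ciInf (hanti h) ⟨0, by rintro _ ⟨k, rfl⟩; exact hunonneg h k⟩⟩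
  choose a ha using hex
  have ha_le : ∀ h, a h ≤ f h := fun h =>
    le_of_tendsto' (ha h) fun k => (hanti h k.zero_le).trans_eq (hu0 h)
  have ha_ge : ∀ h, f h - C ≤ a h := fun h => ge_of_tendsto' (ha h) (hlow h)
  have ha_nonneg : ∀ h, 0 ≤ a h := fun h => ge_of_tendsto' (ha h) (hunonneg h)
  have ha_double : ∀ h, a ((2 : ℤ) • h) = 2 * a h := by
    intro h
    refine tendsto_nhds_unique (ha _) ?_
    have h1 := ((tendsto_add_atTop_iff_nat 1).mpr (ha h)).const_mul 2
    refine h1.congr fun k => ?_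
    simp only [hu, smul_smul, pow_succ]
    field_simp
  have ha_triple : ∀ h, a ((3 : ℤ) • h) ≤ 3 * a h := by
    intro h
    refine le_of_tendsto_of_tendsto' (ha _) ((ha h).const_mul 3) fun k => ?_
    simp only [hu]
    rw [← mul_div_assoc, smul_comm]
    gcongr
    exact htriple _
  have ha_lip : ∀ h₁ h₂, |a h₁ - a h₂| ≤ nrm (fun i => (h₁ i : ℝ) - (h₂ i : ℝ)) := by
    intro h₁ h₂
    have hlim : Tendsto (fun k : ℕ => nrm (fun i => (h₁ i : ℝ) - (h₂ i : ℝ)) + C * (1 / 2) ^ k)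
        atTop (𝓝 (nrm (fun i => (h₁ i : ℝ) - (h₂ i : ℝ)) + C * 0)) :=
      ((tendsto_pow_atTop_nhds_zero_of_lt_one (by norm_num) (by norm_num)).const_mul C).const_add _
    rw [mul_zero, add_zero] at hlim
    refine le_of_tendsto_of_tendsto' ((ha h₁).sub (ha h₂)).abs hlim fun k => ?_
    have h1 := hlip ((2 ^ k : ℤ) • h₁) ((2 ^ k : ℤ) • h₂)
    have hk : (0 : ℝ) < 2 ^ k := by positivity
    have h2 : (fun i => ((((2 ^ k : ℤ) • h₁) i : ℤ) : ℝ) - ((((2 ^ k : ℤ) • h₂) i : ℤ) : ℝ))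
        = (2 ^ k : ℝ) • (fun i => (h₁ i : ℝ) - (h₂ i : ℝ)) := by
      ext i
      simp [mul_sub]
    rw [h2, nrm_smul, abs_of_pos hk] at h1
    simp only [hu]
    rw [← sub_div, abs_div, abs_of_pos hk, div_le_iff₀ hk, add_mul, mul_assoc C, ← mul_pow,
      one_div_mul_cancel two_ne_zero, one_pow]
    linarith
  refine ⟨a, fun n h => ?_, fun h => ?_⟩
  · have := eq_natCast_mul_of_double_of_triple_le (g := fun n => a (n • h))
      (L := nrm (fun i => (h i : ℝ))) (fun n => ha_nonneg _) (fun p q => ?_) (fun n => ?_)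
      (fun n => ?_) n
    · simpa using this
    · have h1 := ha_lip (p • h) (q • h)
      have h2 : (fun i => (((p • h) i : ℤ) : ℝ) - (((q • h) i : ℤ) : ℝ))
          = ((p : ℝ) - q) • (fun i => (h i : ℝ)) := by
        ext i
        simp [sub_mul]
      rwa [h2, nrm_smul] at h1
    · rw [mul_smul, ← ha_double, ← natCast_zsmul (n • h) 2, Nat.cast_ofNat]
    · have h1 := ha_triple (n • h)
      rwa [mul_smul, ← natCast_zsmul (n • h) 3, Nat.cast_ofNat]
  · rw [abs_le]
    constructor <;> linarith [ha_le h, ha_ge h]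
end

section
/- Let (V,‖·‖) be a real normed vector space of finite dimension b ≥ 1, let K ⊆ V be a closed convex cone with nonempty interior and K ≠ V, and let D ⊆ K be a dense subset of K. Then for every ε > 0 there exist N ∈ ℕ and k₁,…,k_N ∈ D such that K_ε := {v ∈ K : dist(v, ∂K) ≥ ε‖v‖} is contained in the positive span {λ₁k₁ + ⋯ + λ_N k_N : λ₁,…,λ_N ≥ 0}. -/
open Set Topology in
/-- In finite dimension, a point interior to the closure of a convex hull is interior to the
convex hull of finitely many of the generating points. -/
theorem exists_finset_mem_interior_convexHull
    {V : Type*} [NormedAddCommGroup V] [NormedSpace ℝ V] [FiniteDimensional ℝ V]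
    {D : Set V} {v : V} (hv : v ∈ interior (closure (convexHull ℝ D))) :
    ∃ F : Finset V, (F : Set V) ⊆ D ∧ v ∈ interior (convexHull ℝ (F : Set V)) := by
  classical
  have hspan : affineSpan ℝ D = ⊤ := by
    have hsub : closure (convexHull ℝ D) ⊆ (affineSpan ℝ D : Set V) :=
      closure_minimal (convexHull_subset_affineSpan D)
        (affineSpan ℝ D).closed_of_finiteDimensional
    have htop := affineSpan_eq_top_of_nonempty_interior
      (s := closure (convexHull ℝ D)) ⟨v, by
        rwa [(convex_convexHull ℝ D).closure.convexHull_eq]⟩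
    exact top_unique (htop ▸ affineSpan_le.2 hsub)
  have hne : (interior (convexHull ℝ D)).Nonempty :=
    interior_convexHull_nonempty_iff_affineSpan_eq_top.2 hspan
  rw [(convex_convexHull ℝ D).interior_closure_eq_interior_of_nonempty_interior hne] at hv
  obtain ⟨b, hvb, hbD⟩ :=
    exists_mem_interior_convexHull_affineBasis (mem_interior_iff_mem_nhds.1 hv)
  have hfin : ∀ i, ∃ t : Finset V, (t : Set V) ⊆ D ∧ b i ∈ convexHull ℝ (t : Set V) := by
    intro i
    have hi := hbD (subset_convexHull ℝ _ (mem_range_self i))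
    rw [convexHull_eq_union_convexHull_finite_subsets] at hi
    simpa using hi
  choose t htD hbt using hfin
  refine ⟨Finset.univ.biUnion t, by simpa using htD, ?_⟩
  refine interior_mono (convexHull_min ?_ (convex_convexHull ℝ _)) hvb
  rintro _ ⟨i, rfl⟩
  refine convexHull_mono ?_ (hbt i)
  exact_mod_cast Finset.subset_biUnion_of_mem t (Finset.mem_univ i)

open Set in
/-- A compact subset of the interior of the closure of a convex hull lies in the convex hull of
finitely many of the generating points. -/
theorem IsCompact.exists_finset_subset_convexHull
    {V : Type*} [NormedAddCommGroup V] [NormedSpace ℝ V] [FiniteDimensional ℝ V]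
    {C D : Set V} (hC : IsCompact C) (hCD : C ⊆ interior (closure (convexHull ℝ D))) :
    ∃ F : Finset V, (F : Set V) ⊆ D ∧ C ⊆ convexHull ℝ (F : Set V) := by
  classical
  have : Nonempty {F : Finset V // (F : Set V) ⊆ D} := ⟨⟨∅, by simp⟩⟩
  obtain ⟨F, hF⟩ := hC.elim_directed_cover
    (fun F : {F : Finset V // (F : Set V) ⊆ D} ↦ interior (convexHull ℝ (F.1 : Set V)))
    (fun _ ↦ isOpen_interior)
    (fun v hv ↦ by
      obtain ⟨F, hFD, hvF⟩ := exists_finset_mem_interior_convexHull (hCD hv)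
      exact mem_iUnion.2 ⟨⟨F, hFD⟩, hvF⟩)
    (fun F G ↦ ⟨⟨F.1 ∪ G.1, by simpa using ⟨F.2, G.2⟩⟩,
      interior_mono (convexHull_mono (by simp)), interior_mono (convexHull_mono (by simp))⟩)
  exact ⟨F.1, F.2, hF.trans interior_subset⟩


open scoped Pointwise in
/-- The frontier of a cone is invariant under scaling by positive reals. -/
theorem smul_frontier_eq_of_cone
    {V : Type*} [NormedAddCommGroup V] [NormedSpace ℝ V] {K : Set V}
    (hcone : ∀ c : ℝ, 0 < c → ∀ v ∈ K, c • v ∈ K) {c : ℝ} (hc : 0 < c) :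
    c • frontier K = frontier K := by
  have hK : c • K = K := by
    ext x
    rw [Set.mem_smul_set_iff_inv_smul_mem₀ hc.ne']
    exact ⟨fun h ↦ by simpa [smul_smul, hc.ne'] using hcone c hc _ h,
      hcone _ (inv_pos.2 hc) x⟩
  rw [frontier, Set.smul_set_sdiff₀ hc.ne', ← closure_smul₀ c, ← interior_smul₀ hc.ne', hK]

/-- The distance to the frontier of a cone is positively homogeneous. -/
theorem infDist_smul_frontier_of_cone
    {V : Type*} [NormedAddCommGroup V] [NormedSpace ℝ V] {K : Set V}
    (hcone : ∀ c : ℝ, 0 < c → ∀ v ∈ K, c • v ∈ K) {c : ℝ} (hc : 0 < c) (v : V) :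
    Metric.infDist (c • v) (frontier K) = c * Metric.infDist v (frontier K) := by
  nth_rewrite 1 [← smul_frontier_eq_of_cone hcone hc]
  rw [infDist_smul₀ hc.ne', Real.norm_of_nonneg hc.le]

/-- For a closed convex cone `K ≠ V` with nonempty interior in a finite-dimensional real
normed space, and a dense subset `D ⊆ K`, every `K_ε` is contained in the positive span
of finitely many elements of `D`. -/
theorem Keps_subset_pos_span_of_dense
    {V : Type*} [NormedAddCommGroup V] [NormedSpace ℝ V] [FiniteDimensional ℝ V]
    (hb : 1 ≤ Module.finrank ℝ V)
    (K : Set V) (hclosed : IsClosed K) (hconv : Convex ℝ K)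
    (hcone : ∀ c : ℝ, 0 < c → ∀ v ∈ K, c • v ∈ K)
    (hint : (interior K).Nonempty) (hKuniv : K ≠ Set.univ)
    (D : Set V) (hDK : D ⊆ K) (hdense : K ⊆ closure D) :
    ∀ ε : ℝ, 0 < ε →
      ∃ (N : ℕ) (k : Fin N → V), (∀ i, k i ∈ D) ∧
        {v | v ∈ K ∧ ε * ‖v‖ ≤ Metric.infDist v (frontier K)} ⊆
          {x | ∃ lam : Fin N → ℝ, (∀ i, 0 ≤ lam i) ∧ x = ∑ i, lam i • k i} := by
  intro ε hε
  have hC : IsCompact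
      (Metric.sphere (0 : V) 1 ∩ {v | v ∈ K ∧ ε * ‖v‖ ≤ Metric.infDist v (frontier K)}) :=
    (isCompact_sphere 0 1).inter_right <| hclosed.inter <|
      isClosed_le (by fun_prop) (Metric.continuous_infDist_pt _)
  obtain ⟨F, hFD, hF⟩ := hC.exists_finset_subset_convexHull (D := D) (by
    rintro v ⟨hv1, hvK, hv⟩
    have hvint : v ∈ interior K := by
      by_contra hvn
      rw [mem_sphere_zero_iff_norm.1 hv1,
        Metric.infDist_zero_of_mem (show v ∈ frontier K from ⟨subset_closure hvK, hvn⟩)] at hv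
      linarith
    exact interior_mono (hdense.trans (closure_mono (subset_convexHull ℝ D))) hvint)
  refine ⟨F.card, fun i ↦ F.equivFin.symm i, fun i ↦ hFD (F.equivFin.symm i).2, ?_⟩
  rintro v ⟨hvK, hv⟩
  rcases eq_or_ne v 0 with rfl | hv0
  · exact ⟨0, fun _ ↦ le_rfl, by simp⟩
  have hpos : 0 < ‖v‖ := norm_pos_iff.2 hv0
  have hmem : ‖v‖⁻¹ • v ∈ convexHull ℝ (F : Set V) := by
    refine hF ⟨by simp [norm_smul, hpos.ne'], hcone _ (inv_pos.2 hpos) v hvK, ?_⟩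
    rw [norm_smul, norm_inv, norm_norm,
      infDist_smul_frontier_of_cone hcone (inv_pos.2 hpos), mul_left_comm]
    gcongr
  obtain ⟨w, hw0, -, hw⟩ := Finset.mem_convexHull'.1 hmem
  refine ⟨fun i ↦ ‖v‖ * w (F.equivFin.symm i), fun i ↦
    mul_nonneg hpos.le (hw0 _ (F.equivFin.symm i).2), ?_⟩
  rw [F.equivFin.symm.sum_comp (fun y : F ↦ (‖v‖ * w y) • (y : V)),
    Finset.sum_coe_sort F (fun y ↦ (‖v‖ * w y) • y)]
  simp_rw [mul_smul]
  rw [← Finset.smul_sum, hw, smul_inv_smul₀ hpos.ne']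
end
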